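/- arXiv:1502.01530 — 2 statements merged into one kernel-verified Lean document; each statement's English description precedes it below -/
import Mathlib

section
/- If U ⊆ B(H) is a hyperreflexive weak* closed masa-bimodule and M ⊆ B(H) is a ternary masa-bimodule, then the algebraic sum U + M is hyperreflexive and k(U + M) ≤ 2·k(U). -/
open scoped InnerProductSpace Pointwise

noncomputable section

namespace SchurHyper

/-- `B H` is the algebra of bounded linear operators on `H`. -/
abbrev B (H : Type*) [NormedAddCommGroup H] [InnerProductSpace ℂ H] : Type _ := H →L[ℂ] H

variable (H : Type*) [NormedAddCommGroup H] [InnerProductSpace ℂ H]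

/-- A linear functional on `B H` is *normal* (weak* continuous) if it arises from
the duality with the trace class, i.e. it is of the form
`T ↦ ∑ₙ ⟪yₙ, T xₙ⟫` for square-summable sequences `(xₙ)`, `(yₙ)`
(recall that the inner product is conjugate-linear in its first slot). -/
def IsNormalFunctional (ω : B H →ₗ[ℂ] ℂ) : Prop :=
  ∃ x y : ℕ → H, Summable (fun n => ‖x n‖ ^ 2) ∧ Summable (fun n => ‖y n‖ ^ 2) ∧
    ∀ T : B H, ω T = ∑' n, ⟪y n, T (x n)⟫_ℂ

/-- The weak* topology on `B H`: the topology induced by the normal functionals. -/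
def weakStarTopology : TopologicalSpace (B H) :=
  TopologicalSpace.induced
    (fun (T : B H) (ω : {ω : B H →ₗ[ℂ] ℂ // IsNormalFunctional H ω}) => ω.1 T)
    inferInstance

/-- A set of operators is weak* closed if it is closed in the weak* topology. -/
def WStarClosed (X : Set (B H)) : Prop := @IsClosed _ (weakStarTopology H) X

/-- The weak* closure of a set of operators. -/
def wStarClosure (X : Set (B H)) : Set (B H) := @closure _ (weakStarTopology H) X

/-- A map on `B H` is weak* continuous if it is continuous with respect to the
weak* topology on both sides. -/
def WStarContinuous (Φ : B H →L[ℂ] B H) : Prop :=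
  @Continuous _ _ (weakStarTopology H) (weakStarTopology H) Φ

variable {H}
variable [CompleteSpace H]

/-- A maximal abelian selfadjoint subalgebra of `B H`: an abelian selfadjoint
subalgebra which contains every operator commuting with it (equivalently, it
coincides with its own commutant). -/
def IsMasa (D : StarSubalgebra ℂ (B H)) : Prop :=
  (∀ A ∈ D, ∀ C ∈ D, A * C = C * A) ∧
  (∀ T : B H, (∀ A ∈ D, T * A = A * T) → T ∈ D)

/-- A Schur multiplier: a weak* continuous `D`-bimodule map on `B H`. -/
def IsSchurMultiplier (D : StarSubalgebra ℂ (B H)) (Φ : B H →L[ℂ] B H) : Prop :=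
  WStarContinuous H Φ ∧ ∀ A ∈ D, ∀ C ∈ D, ∀ T : B H, Φ (A * T * C) = A * Φ T * C

/-- A Schur idempotent: an idempotent Schur multiplier. -/
def IsSchurIdempotent (D : StarSubalgebra ℂ (B H)) (Φ : B H →L[ℂ] B H) : Prop :=
  IsSchurMultiplier D Φ ∧ Φ.comp Φ = Φ

/-- A subspace `X ⊆ B H` is a `D`-bimodule if `D X D ⊆ X`. -/
def IsBimodule (D : StarSubalgebra ℂ (B H)) (X : Submodule ℂ (B H)) : Prop :=
  ∀ A ∈ D, ∀ C ∈ D, ∀ T ∈ X, A * T * C ∈ X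

/-- The Arveson distance `α(T, X)`. -/
def arveson (T : B H) (X : Set (B H)) : ℝ :=
  ⨆ ξ : {ξ : H // ‖ξ‖ = 1}, ⨅ S : X, ‖T ξ.1 - S.1 ξ.1‖

/-- The set of hyperreflexivity constants of `X`. -/
def hyperSet (X : Set (B H)) : Set ℝ :=
  {k | 0 < k ∧ ∀ T : B H, Metric.infDist T X ≤ k * arveson T X}

/-- A subspace is hyperreflexive if `d(T, X) ≤ k ⬝ α(T, X)` for some `k > 0`. -/
def Hyperreflexive (X : Set (B H)) : Prop := (hyperSet X).Nonempty

/-- The hyperreflexivity constant `k(X)`: the least constant that works. -/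
def hyperConst (X : Set (B H)) : ℝ := sInf (hyperSet X)

/-- The set of constants `λ` witnessing that a Schur idempotent lies in `𝔉H`. -/
def lamSet (Φ : B H →L[ℂ] B H) : Set ℝ :=
  {l | 0 < l ∧ ∀ T : B H, ‖T - Φ T‖ ≤ l * arveson T (Set.range Φ)}

/-- The class `𝔉H` of Schur idempotents `Φ` such that
`‖T - Φ T‖ ≤ λ ⬝ α(T, ran Φ)` for some `λ > 0` and all `T`. -/
def MemFH (D : StarSubalgebra ℂ (B H)) (Φ : B H →L[ℂ] B H) : Prop :=
  IsSchurIdempotent D Φ ∧ (lamSet Φ).Nonempty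

/-- The constant `λ(Φ)`: the least constant witnessing membership of `𝔉H`. -/
def lam (Φ : B H →L[ℂ] B H) : ℝ := sInf (lamSet Φ)

/-- A ternary masa-bimodule condition: `S T* R ∈ M` whenever `S, T, R ∈ M`. -/
def IsTernary (M : Submodule ℂ (B H)) : Prop :=
  ∀ S ∈ M, ∀ T ∈ M, ∀ R ∈ M, S * star T * R ∈ M

end SchurHyper

open SchurHyper
open Filter Topology

section Intertwining

variable {E F : Type*} [NormedAddCommGroup E] [InnerProductSpace ℂ E]
  [NormedAddCommGroup F] [InnerProductSpace ℂ F]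

/-- If `S` maps `P` into `Q` and its adjoint maps `Q` into `P`, then `S` intertwines the
orthogonal projections onto `P` and `Q`. -/
theorem starProjection_intertwine (S : E →L[ℂ] F) (S' : F →L[ℂ] E)
    (hS : ∀ u v, ⟪S u, v⟫_ℂ = ⟪u, S' v⟫_ℂ) (P : Submodule ℂ E) (Q : Submodule ℂ F)
    [P.HasOrthogonalProjection] [Q.HasOrthogonalProjection]
    (hPQ : ∀ u ∈ P, S u ∈ Q) (hQP : ∀ v ∈ Q, S' v ∈ P) (u : E) :
    S (P.starProjection u) = Q.starProjection (S u) := by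
  symm
  refine Submodule.eq_starProjection_of_mem_orthogonal
    (hPQ _ (P.starProjection_apply_mem u)) ?_
  rw [← map_sub, Submodule.mem_orthogonal']
  intro q hq
  rw [hS]
  exact (Submodule.mem_orthogonal' _ _).1 (P.sub_starProjection_mem_orthogonal u) _ (hQP q hq)

end Intertwining

section FunctionalCalculus

variable {H : Type*} [NormedAddCommGroup H] [InnerProductSpace ℂ H] [CompleteSpace H]

theorem spectrum_real_subset_Icc {a : B H} (ha1 : ‖a‖ ≤ 1) :
    spectrum ℝ a ⊆ Set.Icc (-1) 1 := by
  intro t ht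
  have h := spectrum.norm_le_norm_mul_of_mem ht
  have h1 : ‖(1 : B H)‖ ≤ 1 := ContinuousLinearMap.norm_id_le
  rw [Real.norm_eq_abs] at h
  exact abs_le.1 (h.trans (mul_le_one₀ ha1 (norm_nonneg _) h1))

omit [CompleteSpace H] in
theorem aeval_intertwine {a b S : B H} (h : S * a = b * S) (p : Polynomial ℝ) :
    S * Polynomial.aeval a p = Polynomial.aeval b p * S := by
  induction p using Polynomial.induction_on' with
  | add p q hp hq => simp [mul_add, add_mul, hp, hq]
  | monomial n c =>
    have : S * a ^ n = b ^ n * S := (show SemiconjBy S a b from h).pow_right n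
    simp [Polynomial.aeval_monomial, Algebra.algebraMap_eq_smul_one, this]

theorem cfc_intertwine {a b S : B H} (ha : IsSelfAdjoint a) (hb : IsSelfAdjoint b)
    (ha1 : ‖a‖ ≤ 1) (hb1 : ‖b‖ ≤ 1) (h : S * a = b * S) {f : ℝ → ℝ} (hf : Continuous f) :
    S * cfc f a = cfc f b * S := by
  have key : ∀ ε > 0, ‖S * cfc f a - cfc f b * S‖ ≤ 2 * ‖S‖ * ε := by
    intro ε hε
    obtain ⟨p, hp⟩ := exists_polynomial_near_of_continuousOn (-1) 1 f hf.continuousOn ε hε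
    have approx : ∀ c : B H, IsSelfAdjoint c → ‖c‖ ≤ 1 →
        ‖cfc f c - Polynomial.aeval c p‖ ≤ ε := by
      intro c hc hc1
      rw [← cfc_polynomial p c hc, ← cfc_sub f p.eval c hf.continuousOn p.continuous.continuousOn]
      refine norm_cfc_le hε.le fun x hx => ?_
      rw [Real.norm_eq_abs, abs_sub_comm]
      exact (hp x (spectrum_real_subset_Icc hc1 hx)).le
    have e : S * cfc f a - cfc f b * S =
        S * (cfc f a - Polynomial.aeval a p) - (cfc f b - Polynomial.aeval b p) * S := by
      rw [mul_sub, sub_mul, aeval_intertwine h]; abel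
    rw [e]
    calc _ ≤ ‖S‖ * ε + ε * ‖S‖ := (norm_sub_le _ _).trans (add_le_add
            ((norm_mul_le _ _).trans (by gcongr; exact approx a ha ha1))
            ((norm_mul_le _ _).trans (by gcongr; exact approx b hb hb1)))
      _ = _ := by ring
  rw [← sub_eq_zero, ← norm_le_zero_iff]
  refine le_of_forall_pos_le_add fun ε hε => ?_
  have := key (ε / (2 * ‖S‖ + 1)) (by positivity)
  refine this.trans ?_
  rw [zero_add, mul_div_assoc', div_le_iff₀ (by positivity)]
  nlinarith

/-- The symmetry in the polar decomposition of a selfadjoint operator. -/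
def signSymm (a : B H) : B H :=
  1 - (((cfc (fun t : ℝ => max t 0) a).ker).starProjection +
    ((cfc (fun t : ℝ => max t 0) a).ker).starProjection)

theorem isSelfAdjoint_signSymm (a : B H) : IsSelfAdjoint (signSymm a) := by
  unfold signSymm
  exact (IsSelfAdjoint.one _).sub
    ((isSelfAdjoint_starProjection _).add (isSelfAdjoint_starProjection _))

theorem signSymm_mul_self (a : B H) : signSymm a * signSymm a = 1 := by
  unfold signSymm
  have := ((cfc (fun t : ℝ => max t 0) a).ker).isIdempotentElem_starProjection.eq
  set E := ((cfc (fun t : ℝ => max t 0) a).ker).starProjection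
  simp only [mul_sub, sub_mul, mul_add, add_mul, this, one_mul, mul_one]
  abel

theorem signSymm_mul {a : B H} (ha : IsSelfAdjoint a) :
    signSymm a * a = cfc (fun t : ℝ => |t|) a := by
  set c := cfc (fun t : ℝ => max t 0) a with hc
  set d := cfc (fun t : ℝ => max (-t) 0) a with hd
  set E := (c.ker).starProjection with hE
  have cE : c * E = 0 := by
    ext v
    exact (c.ker).starProjection_apply_mem v
  have cs : IsSelfAdjoint c := cfc_predicate _ a
  have Ec : E * c = 0 := by
    have := congrArg star cE
    rwa [star_mul, cs.star_eq, (isSelfAdjoint_starProjection _).star_eq, star_zero] at this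
  have cd : c * d = 0 := by
    rw [hc, hd, ← cfc_mul (fun t : ℝ => max t 0) (fun t : ℝ => max (-t) 0) a
      (by fun_prop) (by fun_prop), ← cfc_zero ℝ a]
    congr 1
    ext t
    rcases le_total t 0 with h | h
    · simp [h]
    · simp [h]
  have Ed : E * d = d := by
    ext v
    exact Submodule.starProjection_eq_self_iff.2 (congrArg (fun T : B H => T v) cd)
  have acd : a = c - d := by
    rw [hc, hd, ← cfc_sub (fun t : ℝ => max t 0) (fun t : ℝ => max (-t) 0) a
      (by fun_prop) (by fun_prop)]
    conv_lhs => rw [← cfc_id' ℝ a]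
    congr 1
    ext t
    rcases le_total t 0 with h | h
    · simp [h]
    · simp [h]
  have absd : cfc (fun t : ℝ => |t|) a = c + d := by
    rw [hc, hd, ← cfc_add a (fun t : ℝ => max t 0) (fun t : ℝ => max (-t) 0)
      (by fun_prop) (by fun_prop)]
    congr 1
    ext t
    rcases le_total t 0 with h | h
    · simp [h, abs_of_nonpos]
    · simp [h, abs_of_nonneg]
  rw [absd, show signSymm a = 1 - (E + E) from rfl]
  conv_lhs => rw [acd]
  simp only [mul_sub, sub_mul, add_mul, Ec, Ed, one_mul]
  abel

theorem norm_signSymm_le (a : B H) : ‖signSymm a‖ ≤ 1 := by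
  have h : ‖star (signSymm a) * signSymm a‖ = ‖signSymm a‖ * ‖signSymm a‖ :=
    CStarRing.norm_star_mul_self
  rw [(isSelfAdjoint_signSymm a).star_eq, signSymm_mul_self] at h
  have h1 : ‖(1 : B H)‖ ≤ 1 := ContinuousLinearMap.norm_id_le
  nlinarith [norm_nonneg (signSymm a)]

theorem norm_add_self_sub_signSymm {a : B H} (ha : IsSelfAdjoint a) (ha1 : ‖a‖ ≤ 1) :
    ‖a + a - signSymm a‖ ≤ 1 := by
  have e : a + a - signSymm a = signSymm a * cfc (fun t : ℝ => 2 * |t| - 1) a := by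
    rw [cfc_sub (fun t : ℝ => 2 * |t|) (fun _ => 1) a (by fun_prop) (by fun_prop),
      cfc_const_mul 2 (fun t : ℝ => |t|) a (by fun_prop), cfc_const_one ℝ a, ← signSymm_mul ha,
      mul_sub, mul_smul_comm, ← mul_assoc, signSymm_mul_self, one_mul, mul_one, two_smul]
  rw [e]
  refine (norm_mul_le _ _).trans (mul_le_one₀ (norm_signSymm_le a) (norm_nonneg _) ?_)
  refine norm_cfc_le zero_le_one fun x hx => ?_
  have := abs_le.2 (spectrum_real_subset_Icc ha1 hx)
  rw [Real.norm_eq_abs, abs_le]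
  constructor <;> linarith [abs_nonneg x]

theorem signSymm_intertwine {a b S : B H} (ha : IsSelfAdjoint a) (hb : IsSelfAdjoint b)
    (ha1 : ‖a‖ ≤ 1) (hb1 : ‖b‖ ≤ 1) (h : S * a = b * S) :
    S * signSymm a = signSymm b * S := by
  have hf : Continuous fun t : ℝ => max t 0 := by fun_prop
  have h1 := cfc_intertwine ha hb ha1 hb1 h hf
  have h' : star S * b = a * star S := by
    simpa [ha.star_eq, hb.star_eq] using (congrArg star h).symm
  have h2 := cfc_intertwine hb ha hb1 ha1 h' hf
  set c := cfc (fun t : ℝ => max t 0) a with hc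
  set d := cfc (fun t : ℝ => max t 0) b with hd
  have key : S * (c.ker).starProjection = (d.ker).starProjection * S := by
    ext u
    refine starProjection_intertwine S (star S)
      (fun u v => (ContinuousLinearMap.adjoint_inner_right S u v).symm) c.ker d.ker ?_ ?_ u
    · intro u (hu : c u = 0)
      have := congrArg (fun T : B H => T u) h1
      simp only [mul_apply_eq_comp, hu, map_zero] at this
      exact this.symm
    · intro u (hu : d u = 0)
      have := congrArg (fun T : B H => T u) h2
      simp only [mul_apply_eq_comp, hu, map_zero] at this
      exact this.symm
  show S * (1 - ((c.ker).starProjection + (c.ker).starProjection)) =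
    (1 - ((d.ker).starProjection + (d.ker).starProjection)) * S
  rw [mul_sub, sub_mul, mul_add, add_mul, key, one_mul, mul_one]

end FunctionalCalculus

section Structure

variable {H : Type*} [NormedAddCommGroup H] [InnerProductSpace ℂ H] [CompleteSpace H]

/-- The pairs of operators in `D` which, together with their adjoints, intertwine
every operator in `M`. -/
def intertwiners (D : StarSubalgebra ℂ (B H)) (M : Submodule ℂ (B H)) : Set (B H × B H) :=
  {p | p.1 ∈ D ∧ p.2 ∈ D ∧ ∀ S ∈ M, S * p.1 = p.2 * S ∧ S * star p.1 = star p.2 * S}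

/-- The pairs of symmetries in `D` which intertwine every operator in `M`. -/
def symmPairs (D : StarSubalgebra ℂ (B H)) (M : Submodule ℂ (B H)) : Set (B H × B H) :=
  {p | p.1 ∈ D ∧ p.2 ∈ D ∧ IsSelfAdjoint p.1 ∧ IsSelfAdjoint p.2 ∧
    p.1 * p.1 = 1 ∧ p.2 * p.2 = 1 ∧ ∀ S ∈ M, S * p.1 = p.2 * S}

variable {D : StarSubalgebra ℂ (B H)} {M : Submodule ℂ (B H)}

theorem signSymm_mem (hD : IsMasa D) {a : B H} (ha : IsSelfAdjoint a) (ha1 : ‖a‖ ≤ 1)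
    (haD : a ∈ D) : signSymm a ∈ D :=
  hD.2 _ fun d hd => (signSymm_intertwine ha ha ha1 ha1 (hD.1 d hd a haD)).symm

theorem signSymm_mem_symmPairs (hD : IsMasa D) {a b : B H} (ha : IsSelfAdjoint a)
    (hb : IsSelfAdjoint b) (ha1 : ‖a‖ ≤ 1) (hb1 : ‖b‖ ≤ 1) (h : (a, b) ∈ intertwiners D M) :
    (signSymm a, signSymm b) ∈ symmPairs D M :=
  ⟨signSymm_mem hD ha ha1 h.1, signSymm_mem hD hb hb1 h.2.1, isSelfAdjoint_signSymm a,
    isSelfAdjoint_signSymm b, signSymm_mul_self a, signSymm_mul_self b,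
    fun S hS => signSymm_intertwine ha hb ha1 hb1 (h.2.2 S hS).1⟩

theorem intertwiners_add {p q : B H × B H} (hp : p ∈ intertwiners D M)
    (hq : q ∈ intertwiners D M) : p + q ∈ intertwiners D M := by
  refine ⟨add_mem hp.1 hq.1, add_mem hp.2.1 hq.2.1, fun S hS => ?_⟩
  obtain ⟨h1, h2⟩ := hp.2.2 S hS
  obtain ⟨h3, h4⟩ := hq.2.2 S hS
  simp [mul_add, add_mul, h1, h2, h3, h4]

theorem intertwiners_smul (c : ℂ) {p : B H × B H} (hp : p ∈ intertwiners D M) :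
    c • p ∈ intertwiners D M := by
  refine ⟨D.smul_mem hp.1 c, D.smul_mem hp.2.1 c, fun S hS => ?_⟩
  obtain ⟨h1, h2⟩ := hp.2.2 S hS
  simp [h1, h2]

theorem intertwiners_star {p : B H × B H} (hp : p ∈ intertwiners D M) :
    star p ∈ intertwiners D M := by
  refine ⟨star_mem hp.1, star_mem hp.2.1, fun S hS => ?_⟩
  obtain ⟨h1, h2⟩ := hp.2.2 S hS
  simp [h1, h2]

theorem symmPairs_subset {p : B H × B H} (hp : p ∈ symmPairs D M) :
    p ∈ intertwiners D M := by
  obtain ⟨h1, h2, h3, h4, -, -, h5⟩ := hp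
  refine ⟨h1, h2, fun S hS => ?_⟩
  rw [h3.star_eq, h4.star_eq]
  exact ⟨h5 S hS, h5 S hS⟩

/-- An operator which intertwines all pairs of symmetries almost intertwines every
contractive selfadjoint pair: successively halve the commutator. -/
theorem norm_commutator_le (hD : IsMasa D) {X : B H}
    (hX : ∀ p ∈ symmPairs D M, X * p.1 = p.2 * X) (n : ℕ) :
    ∀ a b : B H, IsSelfAdjoint a → IsSelfAdjoint b → ‖a‖ ≤ 1 → ‖b‖ ≤ 1 →
      (a, b) ∈ intertwiners D M → ‖X * a - b * X‖ ≤ 2 * ‖X‖ * (1 / 2) ^ n := by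
  induction n with
  | zero =>
    intro a b _ _ ha1 hb1 _
    calc ‖X * a - b * X‖ ≤ ‖X‖ * 1 + 1 * ‖X‖ := (norm_sub_le _ _).trans (add_le_add
            ((norm_mul_le _ _).trans (by gcongr)) ((norm_mul_le _ _).trans (by gcongr)))
      _ = _ := by ring
  | succ n ih =>
    intro a b ha hb ha1 hb1 h
    have hs := signSymm_mem_symmPairs hD ha hb ha1 hb1 h
    have hmem : (a + a - signSymm a, b + b - signSymm b) ∈ intertwiners D M := by
      have := intertwiners_add (intertwiners_smul 2 h)
        (intertwiners_smul (-1) (symmPairs_subset hs))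
      rwa [two_smul, neg_one_smul, ← sub_eq_add_neg] at this
    have := ih _ _ ((ha.add ha).sub (isSelfAdjoint_signSymm a))
      ((hb.add hb).sub (isSelfAdjoint_signSymm b)) (norm_add_self_sub_signSymm ha ha1)
      (norm_add_self_sub_signSymm hb hb1) hmem
    have e : X * (a + a - signSymm a) - (b + b - signSymm b) * X =
        (2 : ℂ) • (X * a - b * X) := by
      simp only [two_smul, mul_sub, sub_mul, mul_add, add_mul, hX _ hs]
      abel
    rw [e, norm_smul, Complex.norm_ofNat] at this
    rw [pow_succ]
    linarith

theorem intertwines_of_contraction (hD : IsMasa D) {X : B H}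
    (hX : ∀ p ∈ symmPairs D M, X * p.1 = p.2 * X) {a b : B H} (ha : IsSelfAdjoint a)
    (hb : IsSelfAdjoint b) (ha1 : ‖a‖ ≤ 1) (hb1 : ‖b‖ ≤ 1) (h : (a, b) ∈ intertwiners D M) :
    X * a = b * X := by
  have hlim : Tendsto (fun n : ℕ => 2 * ‖X‖ * (1 / 2 : ℝ) ^ n) atTop (𝓝 0) := by
    simpa using (tendsto_pow_atTop_nhds_zero_of_lt_one (r := (1 / 2 : ℝ)) (by norm_num)
      (by norm_num)).const_mul (2 * ‖X‖)
  rw [← sub_eq_zero, ← norm_le_zero_iff]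
  exact ge_of_tendsto' hlim fun n => norm_commutator_le hD hX n a b ha hb ha1 hb1 h

theorem intertwines_of_isSelfAdjoint (hD : IsMasa D) {X : B H}
    (hX : ∀ p ∈ symmPairs D M, X * p.1 = p.2 * X) {a b : B H} (ha : IsSelfAdjoint a)
    (hb : IsSelfAdjoint b) (h : (a, b) ∈ intertwiners D M) : X * a = b * X := by
  obtain ⟨r, hr0, har, hbr⟩ : ∃ r : ℝ, 0 < r ∧ r * ‖a‖ ≤ 1 ∧ r * ‖b‖ ≤ 1 := by
    have hpos : 0 < max ‖a‖ ‖b‖ + 1 := by positivity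
    refine ⟨(max ‖a‖ ‖b‖ + 1)⁻¹, inv_pos.2 hpos, ?_, ?_⟩
    · rw [inv_mul_le_iff₀ hpos]
      linarith [le_max_left ‖a‖ ‖b‖]
    · rw [inv_mul_le_iff₀ hpos]
      linarith [le_max_right ‖a‖ ‖b‖]
  have hle : ∀ c : B H, r * ‖c‖ ≤ 1 → ‖(r : ℂ) • c‖ ≤ 1 := by
    intro c hc
    rwa [norm_smul, Complex.norm_real, Real.norm_of_nonneg hr0.le]
  have hsa : ∀ c : B H, IsSelfAdjoint c → IsSelfAdjoint ((r : ℂ) • c) := by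
    intro c hc
    rw [isSelfAdjoint_iff, star_smul, hc.star_eq, Complex.star_def, Complex.conj_ofReal]
  have h0 := intertwines_of_contraction hD hX (hsa a ha) (hsa b hb) (hle a har) (hle b hbr)
    (intertwiners_smul (r : ℂ) h)
  rw [mul_smul_comm, smul_mul_assoc] at h0
  exact smul_right_injective (B H) (Complex.ofReal_ne_zero.2 hr0.ne') h0

theorem intertwines_of_mem (hD : IsMasa D) {X : B H}
    (hX : ∀ p ∈ symmPairs D M, X * p.1 = p.2 * X) {p : B H × B H}
    (h : p ∈ intertwiners D M) : X * p.1 = p.2 * X := by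
  have hs := intertwiners_star h
  have hre : p + star p ∈ intertwiners D M := intertwiners_add h hs
  have him : Complex.I • (p + (-1 : ℂ) • star p) ∈ intertwiners D M :=
    intertwiners_smul _ (intertwiners_add h (intertwiners_smul _ hs))
  have e1 := intertwines_of_isSelfAdjoint hD hX (IsSelfAdjoint.add_star_self p.1)
    (IsSelfAdjoint.add_star_self p.2) hre
  have sa : ∀ c : B H, IsSelfAdjoint (Complex.I • (c + (-1 : ℂ) • star c)) := by
    intro c
    rw [isSelfAdjoint_iff]
    simp [star_smul]
    abel
  have e2 := intertwines_of_isSelfAdjoint hD hX (sa p.1) (sa p.2) him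
  rw [mul_smul_comm, smul_mul_assoc] at e2
  have e3 := smul_right_injective (B H) Complex.I_ne_zero e2
  simp only [neg_smul, one_smul, mul_add, add_mul, mul_neg, neg_mul] at e1 e3
  have e4 : (2 : ℂ) • (X * p.1) = (2 : ℂ) • (p.2 * X) := by
    simp only [two_smul]
    have := congrArg₂ (· + ·) e1 e3
    convert this using 1 <;> abel
  exact smul_right_injective (B H) two_ne_zero e4

end Structure

section Ampliation

variable {H : Type*} [NormedAddCommGroup H] [InnerProductSpace ℂ H] {ι : Type*}

/-- The ampliation of `T` to `ℓ²(ι, H)`. -/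
def ampl (ι : Type*) (T : B H) : lp (fun _ : ι => H) 2 →L[ℂ] lp (fun _ : ι => H) 2 :=
  lp.mapCLM 2 (fun _ => T) (norm_nonneg T) fun _ => le_rfl

theorem ampl_coe (T : B H) (v : lp (fun _ : ι => H) 2) (i : ι) : ampl ι T v i = T (v i) := rfl

theorem ampl_inner [CompleteSpace H] (T : B H) (u v : lp (fun _ : ι => H) 2) :
    ⟪ampl ι T u, v⟫_ℂ = ⟪u, ampl ι (star T) v⟫_ℂ := by
  rw [lp.inner_eq_tsum, lp.inner_eq_tsum]
  refine tsum_congr fun i => ?_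
  exact (ContinuousLinearMap.adjoint_inner_right T (u i) (v i)).symm

/-- The linear map `T ↦ (T xᵢ)ᵢ`. -/
def amplOrbit (x : lp (fun _ : ι => H) 2) : B H →ₗ[ℂ] lp (fun _ : ι => H) 2 where
  toFun T := ampl ι T x
  map_add' _ _ := by ext; rfl
  map_smul' _ _ := by ext; rfl

variable [DecidableEq ι]

/-- The `(i, j)` entry of an operator on `ℓ²(ι, H)`. -/
def entry (i j : ι) (P : lp (fun _ : ι => H) 2 →L[ℂ] lp (fun _ : ι => H) 2) : B H :=
  (lp.evalCLM ℂ (fun _ : ι => H) 2 i) ∘L P ∘L (lp.singleContinuousLinearMap ℂ (fun _ : ι => H) 2 j)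

theorem entry_apply (i j : ι) (P : lp (fun _ : ι => H) 2 →L[ℂ] lp (fun _ : ι => H) 2) (v : H) :
    entry i j P v = P (lp.single 2 j v) i := rfl

theorem ampl_single (T : B H) (j : ι) (v : H) :
    ampl ι T (lp.single 2 j v) = lp.single 2 j (T v) := by
  ext k
  rw [ampl_coe, lp.single_apply, lp.single_apply]
  by_cases h : k = j
  · subst h; simp
  · simp [Pi.single_eq_of_ne h]

theorem ampl_mul_eq_iff (S T : B H)
    (P Q : lp (fun _ : ι => H) 2 →L[ℂ] lp (fun _ : ι => H) 2) :
    (∀ v, ampl ι S (P v) = Q (ampl ι T v)) ↔ ∀ i j, S * entry i j P = entry i j Q * T := by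
  constructor
  · intro h i j
    ext v
    simp only [mul_apply_eq_comp, entry_apply]
    rw [← ampl_coe, h, ampl_single]
  · intro h
    suffices (ampl ι S) ∘L P = Q ∘L (ampl ι T) from fun v => congrArg (fun A => A v) this
    refine lp.ext_continuousLinearMap (by simp) fun j => ?_
    ext v i
    have := congrArg (fun A : B H => A v) (h i j)
    simp only [mul_apply_eq_comp, entry_apply] at this
    simp only [ContinuousLinearMap.comp_apply, lp.singleContinuousLinearMap_apply, ampl_single,
      ampl_coe]
    exact this

end Ampliation

section Reflexivity

variable {H : Type*} [NormedAddCommGroup H] [InnerProductSpace ℂ H] [CompleteSpace H]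
variable {D : StarSubalgebra ℂ (B H)} {M : Submodule ℂ (B H)} {ι : Type*}

omit [CompleteSpace H] in
theorem ampl_mapsTo_closure {A C : Submodule ℂ (B H)} {S : B H} (h : ∀ T ∈ A, S * T ∈ C)
    (x : lp (fun _ : ι => H) 2) :
    ∀ v ∈ (A.map (amplOrbit x)).topologicalClosure,
      ampl ι S v ∈ (C.map (amplOrbit x)).topologicalClosure := by
  intro v hv
  refine (show Set.MapsTo (ampl ι S) (A.map (amplOrbit x)) (C.map (amplOrbit x)) from ?_).closure
    (ampl ι S).continuous hv
  rintro _ ⟨T, hT, rfl⟩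
  exact ⟨S * T, h T hT, rfl⟩

/-- The operators `A` such that `M A ⊆ M`. -/
def rightMultipliers (M : Submodule ℂ (B H)) : Submodule ℂ (B H) where
  carrier := {A | ∀ S ∈ M, S * A ∈ M}
  add_mem' ha hb S hS := by rw [mul_add]; exact add_mem (ha S hS) (hb S hS)
  zero_mem' S _ := by rw [mul_zero]; exact zero_mem M
  smul_mem' c A hA S hS := by rw [mul_smul_comm]; exact M.smul_mem c (hA S hS)

/-- An operator which intertwines the pairs of symmetries attached to `M` maps every
square summable sequence into the closed orbit of that sequence under `M`. -/
theorem ampl_mem_closure (hD : IsMasa D) (hMbim : IsBimodule D M) (hMter : IsTernary M) {X : B H}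
    (hX : ∀ p ∈ symmPairs D M, X * p.1 = p.2 * X) (x : lp (fun _ : ι => H) 2) :
    ampl ι X x ∈ (M.map (amplOrbit x)).topologicalClosure := by
  classical
  set R := rightMultipliers M
  set P := (R.map (amplOrbit x)).topologicalClosure
  set Q := (M.map (amplOrbit x)).topologicalClosure
  have : CompleteSpace P := (Submodule.isClosed_topologicalClosure _).completeSpace_coe
  have : CompleteSpace Q := (Submodule.isClosed_topologicalClosure _).completeSpace_coe
  have hMr : ∀ S ∈ M, ∀ d ∈ D, S * d ∈ M := fun S hS d hd => by
    simpa using hMbim 1 (one_mem D) d hd S hS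
  have hMl : ∀ S ∈ M, ∀ d ∈ D, d * S ∈ M := fun S hS d hd => by
    simpa using hMbim d hd 1 (one_mem D) S hS
  have hDP : ∀ d ∈ D, ∀ v ∈ P, ampl ι d v ∈ P := fun d hd =>
    ampl_mapsTo_closure (fun A hA S hS => by
      rw [← mul_assoc]; exact hA _ (hMr S hS d hd)) x
  have hDQ : ∀ d ∈ D, ∀ v ∈ Q, ampl ι d v ∈ Q := fun d hd =>
    ampl_mapsTo_closure (fun A hA => hMl A hA d hd) x
  have hMP : ∀ S ∈ M, ∀ v ∈ P, ampl ι S v ∈ Q := fun S hS =>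
    ampl_mapsTo_closure (A := R) (fun A hA => hA S hS) x
  have hMQ : ∀ S ∈ M, ∀ v ∈ Q, ampl ι (star S) v ∈ P := fun S hS =>
    ampl_mapsTo_closure (fun A hA T hT => by
      rw [← mul_assoc]; exact hMter T hT S hS A hA) x
  have hxP : x ∈ P := Submodule.le_topologicalClosure _
    ⟨1, fun S hS => by rwa [mul_one], rfl⟩
  have hmem : ∀ i j, (entry i j P.starProjection, entry i j Q.starProjection) ∈
      intertwiners D M := by
    intro i j
    refine ⟨hD.2 _ fun d hd => ?_, hD.2 _ fun d hd => ?_, fun S hS => ⟨?_, ?_⟩⟩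
    · exact ((ampl_mul_eq_iff d d _ _).1 (starProjection_intertwine _ _ (ampl_inner d) P P
        (hDP d hd) (hDP _ (star_mem hd))) i j).symm
    · exact ((ampl_mul_eq_iff d d _ _).1 (starProjection_intertwine _ _ (ampl_inner d) Q Q
        (hDQ d hd) (hDQ _ (star_mem hd))) i j).symm
    · exact (ampl_mul_eq_iff S S _ _).1 (starProjection_intertwine _ _ (ampl_inner S) P Q
        (hMP S hS) (hMQ S hS)) i j
    · have := (ampl_mul_eq_iff (star S) (star S) _ _).1 (starProjection_intertwine _ _
        (ampl_inner (star S)) Q P (hMQ S hS) (by rw [star_star]; exact hMP S hS)) i j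
      simpa using (congrArg star this).symm
  have hXPQ := (ampl_mul_eq_iff X X P.starProjection Q.starProjection).2
    fun i j => intertwines_of_mem hD hX (hmem i j)
  have := hXPQ x
  rw [Submodule.starProjection_eq_self_iff.2 hxP] at this
  exact Submodule.starProjection_eq_self_iff.1 this.symm

omit [InnerProductSpace ℂ H] [CompleteSpace H] in
theorem memℓp_two_iff {x : ι → H} : Memℓp x 2 ↔ Summable fun i => ‖x i‖ ^ 2 := by
  rw [memℓp_gen_iff (by simp)]
  simp

omit [CompleteSpace H] in
theorem norm_functional_le {ω : B H →ₗ[ℂ] ℂ} {y : ℕ → H} {x : ι × ℕ → H} {i : ι}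
    (hy : Memℓp y 2) (hx : Memℓp x 2) (hω : ∀ T : B H, ω T = ∑' n, ⟪y n, T (x (i, n))⟫_ℂ)
    (T : B H) :
    ‖ω T‖ ≤ ‖(⟨y, hy⟩ : lp (fun _ : ℕ => H) 2)‖ *
      ‖ampl (ι × ℕ) T (⟨x, hx⟩ : lp (fun _ : ι × ℕ => H) 2)‖ := by
  set w := ampl (ι × ℕ) T (⟨x, hx⟩ : lp (fun _ : ι × ℕ => H) 2) with hw
  have hs : Summable fun k => ‖w k‖ ^ 2 := memℓp_two_iff.1 (lp.memℓp w)
  have hinj : Function.Injective fun n : ℕ => (i, n) := Prod.mk_right_injective i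
  have hz : Memℓp (fun n : ℕ => w (i, n)) 2 := memℓp_two_iff.2 (hs.comp_injective hinj)
  have hval : ω T =
      ⟪(⟨y, hy⟩ : lp (fun _ : ℕ => H) 2), (⟨_, hz⟩ : lp (fun _ : ℕ => H) 2)⟫_ℂ := by
    rw [lp.inner_eq_tsum]
    exact hω T
  rw [hval]
  refine (norm_inner_le_norm _ _).trans (mul_le_mul_of_nonneg_left ?_ (norm_nonneg _))
  refine lp.norm_le_of_tsum_le (by simp) (norm_nonneg _) ?_
  rw [lp.norm_rpow_eq_tsum (by simp)]
  simp only [ENNReal.toReal_ofNat, Real.rpow_ofNat]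
  exact (hs.comp_injective hinj).tsum_le_tsum_of_inj (fun n : ℕ => (i, n)) hinj
    (fun _ _ => by positivity) (fun _ => le_rfl) hs

theorem exists_mem_approx (hD : IsMasa D) (hMbim : IsBimodule D M) (hMter : IsTernary M)
    {X : B H} (hX : ∀ p ∈ symmPairs D M, X * p.1 = p.2 * X) {I : Type*} [Finite I]
    (ω : I → B H →ₗ[ℂ] ℂ) (hω : ∀ i, IsNormalFunctional H (ω i)) {ε : I → ℝ}
    (hε : ∀ i, 0 < ε i) : ∃ S ∈ M, ∀ i, ‖ω i S - ω i X‖ < ε i := by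
  choose x y hx hy hω using hω
  have hx2 : Memℓp (fun k : I × ℕ => x k.1 k.2) 2 := by
    rw [memℓp_two_iff, summable_prod_of_nonneg (fun _ => by positivity)]
    exact ⟨fun i => hx i, Summable.of_finite⟩
  have hy2 : ∀ i, Memℓp (y i) 2 := fun i => memℓp_two_iff.2 (hy i)
  have hcl := ampl_mem_closure hD hMbim hMter hX (⟨_, hx2⟩ : lp (fun _ : I × ℕ => H) 2)
  obtain ⟨K, hK⟩ : ∃ K : I → ℝ, ∀ i, K i = ‖(⟨y i, hy2 i⟩ : lp (fun _ : ℕ => H) 2)‖ :=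
    ⟨_, fun _ => rfl⟩
  obtain ⟨δ, hδ, hδε⟩ : ∃ δ > 0, ∀ i : I, K i * δ < ε i := by
    have h : ∀ᶠ δ in 𝓝[>] (0 : ℝ), ∀ i : I, K i * δ < ε i := by
      rw [eventually_all]
      intro i
      have : Tendsto (fun δ : ℝ => K i * δ) (𝓝[>] 0) (𝓝 0) := by
        refine tendsto_nhdsWithin_of_tendsto_nhds ?_
        simpa using (tendsto_id (α := ℝ) (x := 𝓝 0)).const_mul (K i)
      exact this.eventually (gt_mem_nhds (hε i))
    obtain ⟨δ, h1, h2⟩ := (h.and self_mem_nhdsWithin).exists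
    exact ⟨δ, h2, h1⟩
  obtain ⟨_, ⟨S, hS, rfl⟩, hdist⟩ := Metric.mem_closure_iff.1 hcl δ hδ
  refine ⟨S, hS, fun i => lt_of_le_of_lt ?_ (hδε i)⟩
  rw [← map_sub, hK]
  refine (norm_functional_le (hy2 i) hx2 (hω i) (S - X)).trans
    (mul_le_mul_of_nonneg_left ?_ (norm_nonneg _))
  rw [dist_comm, dist_eq_norm] at hdist
  have e := map_sub (amplOrbit (⟨_, hx2⟩ : lp (fun _ : I × ℕ => H) 2)) S X
  exact (congrArg norm e).trans_le hdist.le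

omit [CompleteSpace H] in
theorem mem_of_approx (hMcl : WStarClosed H (M : Set (B H))) {X : B H}
    (h : ∀ (I : Finset {ω : B H →ₗ[ℂ] ℂ // IsNormalFunctional H ω}) (ε : I → ℝ),
      (∀ i, 0 < ε i) → ∃ S ∈ M, ∀ i : I, ‖i.1.1 S - i.1.1 X‖ < ε i) : X ∈ M := by
  obtain ⟨C, hC, hCM⟩ := isClosed_induced_iff.1 hMcl
  by_contra hXM
  have hXC : (fun ω : {ω : B H →ₗ[ℂ] ℂ // IsNormalFunctional H ω} => ω.1 X) ∈ Cᶜ :=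
    fun hmem => hXM (hCM.subset hmem)
  obtain ⟨I, u, hu, hsub⟩ := isOpen_pi_iff.1 hC.isOpen_compl _ hXC
  have hopen : ∀ i : I, ∃ ε > 0, ∀ z : ℂ, ‖z - i.1.1 X‖ < ε → z ∈ u i.1 := by
    intro i
    obtain ⟨ho, hm⟩ := hu i.1 i.2
    obtain ⟨ε, hε, hb⟩ := Metric.isOpen_iff.1 ho _ hm
    exact ⟨ε, hε, fun z hz => hb (by rwa [Metric.mem_ball, dist_eq_norm])⟩
  choose ε hε hball using hopen
  obtain ⟨S, hS, hSI⟩ := h I ε hε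
  exact hsub (fun ω hω => hball ⟨ω, hω⟩ _ (hSI ⟨ω, hω⟩)) (hCM.superset hS)

/-- A weak* closed ternary masa-bimodule consists of the operators which intertwine its
pairs of symmetries. -/
theorem mem_of_intertwines_symmPairs (hD : IsMasa D) (hMbim : IsBimodule D M)
    (hMcl : WStarClosed H (M : Set (B H))) (hMter : IsTernary M) {X : B H}
    (hX : ∀ p ∈ symmPairs D M, X * p.1 = p.2 * X) : X ∈ M :=
  mem_of_approx hMcl fun _ _ hε =>
    exists_mem_approx hD hMbim hMter hX (fun i => i.1.1) (fun i => i.1.2) hε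

end Reflexivity

section WeakLimits

variable {H : Type*} [NormedAddCommGroup H] [InnerProductSpace ℂ H] {κ : Type*}

/-- Bounded families of operators converge weakly along ultrafilters. -/
theorem exists_weak_limit [CompleteSpace H] (l : Ultrafilter κ) {T : κ → B H} {C : ℝ}
    (hT : ∀ i, ‖T i‖ ≤ C) :
    ∃ T₀ : B H, ∀ ξ η, Tendsto (fun i => ⟪η, T i ξ⟫_ℂ) l (𝓝 ⟪η, T₀ ξ⟫_ℂ) := by
  have hbound : ∀ i ξ η, ‖⟪T i ξ, η⟫_ℂ‖ ≤ C * ‖ξ‖ * ‖η‖ := fun i ξ η =>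
    (norm_inner_le_norm _ _).trans (by gcongr; exact (T i).le_of_opNorm_le (hT i) ξ)
  have hex : ∀ ξ η, ∃ z : ℂ, Tendsto (fun i => ⟪T i ξ, η⟫_ℂ) l (𝓝 z) := by
    intro ξ η
    obtain ⟨z, -, hz⟩ := (isCompact_closedBall (0 : ℂ) (C * ‖ξ‖ * ‖η‖)).ultrafilter_le_nhds
      (l.map fun i => ⟪T i ξ, η⟫_ℂ) (by
        rw [Ultrafilter.coe_map, le_principal_iff]
        exact mem_map.2 (Eventually.of_forall fun i => by
          simpa [mem_closedBall_zero_iff] using hbound i ξ η))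
    exact ⟨z, hz⟩
  choose g hg using hex
  let G : H →ₗ⋆[ℂ] H →ₗ[ℂ] ℂ := LinearMap.mk₂'ₛₗ (starRingEnd ℂ) (RingHom.id ℂ) g
    (fun ξ ξ' η => tendsto_nhds_unique (hg _ _)
      (by simpa [inner_add_left] using (hg ξ η).add (hg ξ' η)))
    (fun c ξ η => tendsto_nhds_unique (hg _ _)
      (by simpa [inner_smul_left, mul_comm] using (hg ξ η).const_mul (starRingEnd ℂ c)))
    (fun ξ η η' => tendsto_nhds_unique (hg _ _)
      (by simpa [inner_add_right] using (hg ξ η).add (hg ξ η')))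
    (fun c ξ η => tendsto_nhds_unique (hg _ _)
      (by simpa [inner_smul_right] using (hg ξ η).const_mul c))
  let G' : H →L⋆[ℂ] H →L[ℂ] ℂ := G.mkContinuous₂ C fun ξ η =>
    le_of_tendsto (hg ξ η).norm (Eventually.of_forall fun i => hbound i ξ η)
  refine ⟨InnerProductSpace.continuousLinearMapOfBilin G', fun ξ η => ?_⟩
  have h : ⟪InnerProductSpace.continuousLinearMapOfBilin G' ξ, η⟫_ℂ = g ξ η :=
    InnerProductSpace.continuousLinearMapOfBilin_apply G' ξ η
  rw [← inner_conj_symm, h]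
  exact ((Complex.continuous_conj.tendsto _).comp (hg ξ η)).congr fun i => inner_conj_symm _ _

/-- A weak* closed set contains the weak limits of its bounded families. -/
theorem mem_of_weak_limit {X : Set (B H)} (hX : WStarClosed H X) {l : Filter κ}
    [l.NeBot] {T : κ → B H} {C : ℝ} (hT : ∀ i, ‖T i‖ ≤ C) (hTX : ∀ i, T i ∈ X) {T₀ : B H}
    (hlim : ∀ ξ η, Tendsto (fun i => ⟪η, T i ξ⟫_ℂ) l (𝓝 ⟪η, T₀ ξ⟫_ℂ)) : T₀ ∈ X := by
  let e : B H → {ω : B H →ₗ[ℂ] ℂ // IsNormalFunctional H ω} → ℂ := fun S ω => ω.1 S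
  obtain ⟨K, hK, rfl⟩ : ∃ K, IsClosed K ∧ e ⁻¹' K = X := isClosed_induced_iff.1 hX
  change e T₀ ∈ K
  refine hK.mem_of_tendsto (f := fun i => e (T i)) (b := l) ?_ (Eventually.of_forall hTX)
  rw [tendsto_pi_nhds]
  rintro ⟨ω, x, y, hx, hy, hω⟩
  simp only [e, hω]
  refine tendsto_tsum_of_dominated_convergence
    (bound := fun n => |C| * (‖x n‖ ^ 2 + ‖y n‖ ^ 2)) ((hx.add hy).mul_left _)
    (fun n => hlim (x n) (y n)) (Eventually.of_forall fun i n => ?_)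
  calc ‖⟪y n, T i (x n)⟫_ℂ‖ ≤ ‖y n‖ * (|C| * ‖x n‖) := (norm_inner_le_norm _ _).trans
        (by gcongr; exact (T i).le_of_opNorm_le ((hT i).trans (le_abs_self C)) _)
    _ = |C| * (‖x n‖ * ‖y n‖) := by ring
    _ ≤ _ := by
      gcongr
      nlinarith [sq_nonneg (‖x n‖ - ‖y n‖), sq_nonneg ‖x n‖, sq_nonneg ‖y n‖]

theorem norm_le_of_weak_limit {l : Filter κ} [l.NeBot] {T : κ → B H} {C : ℝ} (hC : 0 ≤ C)
    (hT : ∀ i, ‖T i‖ ≤ C) {T₀ : B H}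
    (hlim : ∀ ξ η, Tendsto (fun i => ⟪η, T i ξ⟫_ℂ) l (𝓝 ⟪η, T₀ ξ⟫_ℂ)) : ‖T₀‖ ≤ C := by
  refine T₀.opNorm_le_bound hC fun ξ => ?_
  have h : ‖⟪T₀ ξ, T₀ ξ⟫_ℂ‖ ≤ ‖T₀ ξ‖ * (C * ‖ξ‖) :=
    le_of_tendsto (hlim ξ (T₀ ξ)).norm (Eventually.of_forall fun i =>
      (norm_inner_le_norm _ _).trans (by gcongr; exact (T i).le_of_opNorm_le (hT i) ξ))
  rw [inner_self_eq_norm_sq_to_K, norm_pow, RCLike.norm_ofReal, abs_norm] at h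
  rcases (norm_nonneg (T₀ ξ)).eq_or_lt with h0 | h0
  · rw [← h0]; positivity
  · nlinarith

end WeakLimits

section Arveson

variable {H : Type*} [NormedAddCommGroup H] [InnerProductSpace ℂ H]

theorem bddBelow_range_norm_sub (T : B H) (X : Set (B H)) (ξ : H) :
    BddBelow (Set.range fun S : X => ‖T ξ - S.1 ξ‖) :=
  ⟨0, by rintro _ ⟨S, rfl⟩; exact norm_nonneg _⟩

theorem arveson_nonneg (T : B H) (X : Set (B H)) : 0 ≤ arveson T X :=
  Real.iSup_nonneg fun _ => Real.iInf_nonneg fun _ => norm_nonneg _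

theorem iInf_le_arveson (T : B H) {X : Set (B H)} (h0 : 0 ∈ X) {ξ : H} (hξ : ‖ξ‖ = 1) :
    ⨅ S : X, ‖T ξ - S.1 ξ‖ ≤ arveson T X := by
  refine le_ciSup (f := fun ξ : {ξ : H // ‖ξ‖ = 1} => ⨅ S : X, ‖T ξ.1 - S.1 ξ.1‖)
    ⟨‖T‖, ?_⟩ ⟨ξ, hξ⟩
  rintro _ ⟨ζ, rfl⟩
  refine (ciInf_le (bddBelow_range_norm_sub T X ζ.1) ⟨0, h0⟩).trans ?_
  simpa [ζ.2] using T.le_opNorm ζ.1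

/-- Rank one functionals annihilating `X` are controlled by the Arveson distance. -/
theorem norm_inner_le_arveson (T : B H) {X : Set (B H)} (h0 : 0 ∈ X) {ξ η : H}
    (h : ∀ S ∈ X, ⟪η, S ξ⟫_ℂ = 0) : ‖⟪η, T ξ⟫_ℂ‖ ≤ arveson T X * ‖η‖ * ‖ξ‖ := by
  rcases eq_or_ne ξ 0 with rfl | hξ
  · simp
  rcases eq_or_ne η 0 with rfl | hη
  · simp
  have hξ0 : 0 < ‖ξ‖ := norm_pos_iff.2 hξ
  have hη0 : 0 < ‖η‖ := norm_pos_iff.2 hη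
  set ζ : H := ((‖ξ‖⁻¹ : ℝ) : ℂ) • ξ with hζ
  have hζ1 : ‖ζ‖ = 1 := by
    rw [hζ, norm_smul, Complex.norm_real, norm_inv, norm_norm, inv_mul_cancel₀ hξ0.ne']
  have hne : Nonempty X := ⟨⟨0, h0⟩⟩
  have key : ‖⟪η, T ξ⟫_ℂ‖ / (‖η‖ * ‖ξ‖) ≤ ⨅ S : X, ‖T ζ - S.1 ζ‖ := by
    refine le_ciInf fun S => ?_
    rw [div_le_iff₀ (by positivity)]
    have e : T ζ - S.1 ζ = ((‖ξ‖⁻¹ : ℝ) : ℂ) • (T ξ - S.1 ξ) := by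
      rw [hζ, map_smul, map_smul, smul_sub]
    rw [e, norm_smul, Complex.norm_real, norm_inv, norm_norm]
    calc ‖⟪η, T ξ⟫_ℂ‖ = ‖⟪η, T ξ - S.1 ξ⟫_ℂ‖ := by rw [inner_sub_right, h S.1 S.2, sub_zero]
      _ ≤ ‖η‖ * ‖T ξ - S.1 ξ‖ := norm_inner_le_norm _ _
      _ = _ := by field_simp
  have := key.trans (iInf_le_arveson T h0 hζ1)
  rwa [div_le_iff₀ (by positivity), ← mul_assoc] at this

/-- The Arveson distance to a subspace is controlled by rank one functionals annihilating it. -/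
theorem arveson_le_of_norm_inner_le [CompleteSpace H] (T : B H) (U : Submodule ℂ (B H)) {C : ℝ} (hC : 0 ≤ C)
    (h : ∀ ξ η : H, (∀ S ∈ U, ⟪η, S ξ⟫_ℂ = 0) → ‖⟪η, T ξ⟫_ℂ‖ ≤ C * ‖η‖ * ‖ξ‖) :
    arveson T U ≤ C := by
  refine Real.iSup_le (fun ⟨ξ, hξ⟩ => ?_) hC
  let W := (U.map (ContinuousLinearMap.apply ℂ H ξ).toLinearMap).topologicalClosure
  have : CompleteSpace W := (Submodule.isClosed_topologicalClosure _).completeSpace_coe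
  set η := T ξ - W.starProjection (T ξ) with hη
  have hηW : η ∈ Wᗮ := W.sub_starProjection_mem_orthogonal _
  have hηU : ∀ S ∈ U, ⟪η, S ξ⟫_ℂ = 0 := fun S hS =>
    (Submodule.mem_orthogonal' _ _).1 hηW _ (Submodule.le_topologicalClosure _ ⟨S, hS, rfl⟩)
  have hself : ⟪η, T ξ⟫_ℂ = ⟪η, η⟫_ℂ := by
    conv_rhs => rw [hη, inner_sub_right, ← hη,
      (Submodule.mem_orthogonal' _ _).1 hηW _ (W.starProjection_apply_mem _), sub_zero]
  have hle := h ξ η hηU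
  rw [hself, inner_self_eq_norm_sq_to_K, norm_pow, RCLike.norm_ofReal, abs_norm, hξ,
    mul_one] at hle
  have hηC : ‖η‖ ≤ C := by
    rcases (norm_nonneg η).eq_or_lt with h0 | h0
    · rwa [← h0]
    · nlinarith
  refine le_of_forall_pos_le_add fun δ hδ => ?_
  obtain ⟨_, ⟨S, hS, rfl⟩, hdist⟩ :=
    Metric.mem_closure_iff.1 (W.starProjection_apply_mem (T ξ)) δ hδ
  refine (ciInf_le (bddBelow_range_norm_sub T U ξ) ⟨S, hS⟩).trans ?_
  rw [dist_eq_norm] at hdist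
  calc ‖T ξ - S ξ‖ = ‖η + (W.starProjection (T ξ) - S ξ)‖ := by rw [hη]; congr 1; abel
    _ ≤ C + δ := (norm_add_le _ _).trans (add_le_add hηC hdist.le)

end Arveson

section Symmetrization

variable {H : Type*} [NormedAddCommGroup H] [InnerProductSpace ℂ H] [CompleteSpace H]
variable {D : StarSubalgebra ℂ (B H)} {M : Submodule ℂ (B H)}

theorem inner_apply_left_of_isSelfAdjoint {k : B H} (hk : IsSelfAdjoint k) (u v : H) :
    ⟪k u, v⟫_ℂ = ⟪u, k v⟫_ℂ := by
  rw [← ContinuousLinearMap.adjoint_inner_right, ← ContinuousLinearMap.star_eq_adjoint, hk.star_eq]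

theorem norm_symm_apply {k : B H} (hk : IsSelfAdjoint k) (h1 : k * k = 1) (v : H) :
    ‖k v‖ = ‖v‖ := by
  have h : ⟪k v, k v⟫_ℂ = ⟪v, v⟫_ℂ := by
    rw [inner_apply_left_of_isSelfAdjoint hk, ← mul_apply_eq_comp, h1]
    rfl
  rw [inner_self_eq_norm_sq_to_K, inner_self_eq_norm_sq_to_K] at h
  have h2 : ‖k v‖ ^ 2 = ‖v‖ ^ 2 := by exact_mod_cast h
  exact (pow_left_inj₀ (norm_nonneg _) (norm_nonneg _) two_ne_zero).1 h2

theorem neg_mem_symmPairs {p : B H × B H} (hp : p ∈ symmPairs D M) : -p ∈ symmPairs D M := by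
  obtain ⟨h1, h2, h3, h4, h5, h6, h7⟩ := hp
  exact ⟨neg_mem h1, neg_mem h2, h3.neg, h4.neg, by simpa using h5, by simpa using h6,
    fun S hS => by simpa using h7 S hS⟩

/-- The conjugates `k T j` of `T` by the pairs of symmetries `(j, k)`. -/
def symmOrbit (D : StarSubalgebra ℂ (B H)) (M : Submodule ℂ (B H)) (T : B H) : Set (B H) :=
  (fun p : B H × B H => p.2 * T * p.1) '' symmPairs D M

theorem mul_mem_symmPairs (hD : IsMasa D) {p q : B H × B H} (hp : p ∈ symmPairs D M)
    (hq : q ∈ symmPairs D M) : p * q ∈ symmPairs D M := by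
  obtain ⟨p1, p2, p3, p4, p5, p6, p7⟩ := hp
  obtain ⟨q1, q2, q3, q4, q5, q6, q7⟩ := hq
  have c1 := hD.1 _ p1 _ q1
  have c2 := hD.1 _ p2 _ q2
  refine ⟨mul_mem p1 q1, mul_mem p2 q2, (p3.commute_iff q3).1 c1, (p4.commute_iff q4).1 c2, ?_, ?_, fun S hS => ?_⟩
  · change p.1 * q.1 * (p.1 * q.1) = 1
    rw [mul_assoc, ← mul_assoc q.1, ← c1, mul_assoc p.1, q5, mul_one, p5]
  · change p.2 * q.2 * (p.2 * q.2) = 1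
    rw [mul_assoc, ← mul_assoc q.2, ← c2, mul_assoc p.2, q6, mul_one, p6]
  · change S * (p.1 * q.1) = p.2 * q.2 * S
    rw [← mul_assoc, p7 S hS, mul_assoc, q7 S hS, mul_assoc]

theorem one_mem_symmPairs : (1 : B H × B H) ∈ symmPairs D M :=
  ⟨one_mem D, one_mem D, .one _, .one _, mul_one _, mul_one _, fun S _ => by simp⟩

theorem conj_mem_convexHull (hD : IsMasa D) {p : B H × B H} (hp : p ∈ symmPairs D M) {T R : B H}
    (hR : R ∈ convexHull ℝ (symmOrbit D M T)) :
    p.2 * R * p.1 ∈ convexHull ℝ (symmOrbit D M T) := by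
  let L : B H →ₗ[ℝ] B H :=
    (LinearMap.mulRight ℝ p.1).comp (LinearMap.mulLeft ℝ p.2)
  have h : symmOrbit D M T ⊆ L ⁻¹' convexHull ℝ (symmOrbit D M T) := by
    rintro _ ⟨q, hq, rfl⟩
    refine subset_convexHull ℝ _ ⟨p * q, mul_mem_symmPairs hD hp hq, ?_⟩
    change p.2 * q.2 * T * (p.1 * q.1) = p.2 * (q.2 * T * q.1) * p.1
    rw [hD.1 _ hp.1 _ hq.1]
    simp only [mul_assoc]
  exact convexHull_min h ((convex_convexHull ℝ _).linear_preimage L) hR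

/-- Averaging over finitely many pairs of symmetries. -/
theorem exists_symmetrization (hD : IsMasa D) (T : B H) (s : Finset (symmPairs D M)) :
    ∃ R ∈ convexHull ℝ (symmOrbit D M T), ∀ p ∈ s, R * p.1.1 = p.1.2 * R := by
  classical
  induction s using Finset.induction_on with
  | empty => exact ⟨T, subset_convexHull ℝ _ ⟨1, one_mem_symmPairs, by simp⟩, by simp⟩
  | insert q s _ ih =>
    obtain ⟨R, hR, hs⟩ := ih
    obtain ⟨⟨j, k⟩, hq⟩ := q
    have hq' := hq
    obtain ⟨hj, hk, -, -, hj1, hk1, -⟩ := hq'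
    dsimp only at hj hk hj1 hk1
    refine ⟨(1 / 2 : ℝ) • R + (1 / 2 : ℝ) • (k * R * j),
      convex_convexHull ℝ _ hR (conj_mem_convexHull (p := (j, k)) hD hq hR) (by norm_num) (by norm_num)
        (by norm_num), fun p hp => ?_⟩
    rw [add_mul, mul_add, smul_mul_assoc, smul_mul_assoc, mul_smul_comm, mul_smul_comm]
    rcases Finset.mem_insert.1 hp with rfl | hp
    · have e1 : k * R * j * j = k * R := by rw [mul_assoc, hj1, mul_one]
      have e2 : k * (k * R * j) = R * j := by rw [← mul_assoc, ← mul_assoc, hk1, one_mul]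
      dsimp only
      rw [e1, e2, add_comm]
    · have e : k * R * j * p.1.1 = p.1.2 * (k * R * j) := by
        rw [mul_assoc, hD.1 _ hj _ p.2.1, ← mul_assoc, mul_assoc k, hs p hp, ← mul_assoc,
          hD.1 _ hk _ p.2.2.1]
        simp only [mul_assoc]
      rw [e, hs p hp]

theorem norm_le_of_mem_convexHull {T R : B H} (hR : R ∈ convexHull ℝ (symmOrbit D M T)) :
    ‖R‖ ≤ ‖T‖ := by
  have h : symmOrbit D M T ⊆ Metric.closedBall 0 ‖T‖ := by
    rintro _ ⟨⟨j, k⟩, ⟨-, -, hj, hk, hj1, hk1, -⟩, rfl⟩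
    rw [mem_closedBall_zero_iff]
    refine ContinuousLinearMap.opNorm_le_bound _ (norm_nonneg _) fun v => ?_
    calc ‖k (T (j v))‖ = ‖T (j v)‖ := norm_symm_apply hk hk1 _
      _ ≤ ‖T‖ * ‖j v‖ := T.le_opNorm _
      _ = ‖T‖ * ‖v‖ := by rw [norm_symm_apply hj hj1]
  exact mem_closedBall_zero_iff.1 (convexHull_min h (convex_closedBall _ _) hR)

theorem norm_inner_sub_conj_le {T : B H} {ξ η : H} {C : ℝ} (hC : 0 ≤ C)
    (h : ∀ p ∈ symmPairs D M,
      ‖⟪η + p.2 η, T (ξ - p.1 ξ)⟫_ℂ‖ ≤ C * ‖η + p.2 η‖ * ‖ξ - p.1 ξ‖)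
    {p : B H × B H} (hp : p ∈ symmPairs D M) :
    ‖⟪η, (T - p.2 * T * p.1) ξ⟫_ℂ‖ ≤ 2 * C * ‖η‖ * ‖ξ‖ := by
  have h1 := h p hp
  have h2 := h (-p) (neg_mem_symmPairs hp)
  obtain ⟨j, k⟩ := p
  obtain ⟨-, -, hj, hk, hj1, hk1, -⟩ := hp
  dsimp only at hj hk hj1 hk1 h1 ⊢
  simp only [Prod.neg_mk, neg_apply, sub_neg_eq_add, ← sub_eq_add_neg] at h2
  have e : 2 * ⟪η, (T - k * T * j) ξ⟫_ℂ = ⟪η + k η, T (ξ - j ξ)⟫_ℂ + ⟪η - k η, T (ξ + j ξ)⟫_ℂ := by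
    have e1 : (T - k * T * j) ξ = T ξ - k (T (j ξ)) := rfl
    rw [e1, inner_sub_right, ← inner_apply_left_of_isSelfAdjoint hk]
    simp only [inner_add_left, inner_sub_left, map_add, map_sub, inner_add_right, inner_sub_right]
    ring
  have pη := parallelogram_law_with_norm ℂ η (k η)
  have pξ := parallelogram_law_with_norm ℂ ξ (j ξ)
  rw [norm_symm_apply hk hk1] at pη
  rw [norm_symm_apply hj hj1] at pξ
  have e2 : 2 * ‖⟪η, (T - k * T * j) ξ⟫_ℂ‖ ≤
      C * (‖η + k η‖ * ‖ξ - j ξ‖ + ‖η - k η‖ * ‖ξ + j ξ‖) := by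
    have := congrArg norm e
    rw [norm_mul, Complex.norm_ofNat] at this
    rw [this]
    refine (norm_add_le _ _).trans ((add_le_add h1 h2).trans_eq ?_)
    ring
  have e3 : ‖η + k η‖ * ‖ξ - j ξ‖ + ‖η - k η‖ * ‖ξ + j ξ‖ ≤ 4 * (‖η‖ * ‖ξ‖) := by
    refine abs_le_of_sq_le_sq' ?_ (by positivity) |>.2
    nlinarith [sq_nonneg (‖η + k η‖ * ‖ξ + j ξ‖ - ‖η - k η‖ * ‖ξ - j ξ‖)]
  nlinarith [mul_le_mul_of_nonneg_left e3 hC]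

theorem norm_inner_sub_le_of_mem_convexHull {T R : B H} {ξ η : H} {C : ℝ} (hC : 0 ≤ C)
    (h : ∀ p ∈ symmPairs D M,
      ‖⟪η + p.2 η, T (ξ - p.1 ξ)⟫_ℂ‖ ≤ C * ‖η + p.2 η‖ * ‖ξ - p.1 ξ‖)
    (hR : R ∈ convexHull ℝ (symmOrbit D M T)) :
    ‖⟪η, (T - R) ξ⟫_ℂ‖ ≤ 2 * C * ‖η‖ * ‖ξ‖ := by
  let L : B H →ₗ[ℝ] ℂ :=
    ((innerSL ℂ η).toLinearMap ∘ₗ (ContinuousLinearMap.apply ℂ H ξ).toLinearMap).restrictScalars ℝ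
  have hL : ∀ S, L S = ⟪η, S ξ⟫_ℂ := fun _ => rfl
  have hsub : symmOrbit D M T ⊆ L ⁻¹' Metric.closedBall (L T) (2 * C * ‖η‖ * ‖ξ‖) := by
    rintro _ ⟨p, hp, rfl⟩
    rw [Set.mem_preimage, Metric.mem_closedBall', dist_eq_norm, ← map_sub, hL]
    exact norm_inner_sub_conj_le hC h hp
  have := convexHull_min hsub ((convex_closedBall _ _).linear_preimage L) hR
  rwa [Set.mem_preimage, Metric.mem_closedBall', dist_eq_norm, ← map_sub, hL] at this

/-- Symmetrizing at most doubles the Arveson distance to `U + M`. -/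
theorem arveson_sub_le {U : Submodule ℂ (B H)} (hUbim : IsBimodule D U) {T R : B H}
    (hR : R ∈ convexHull ℝ (symmOrbit D M T)) :
    arveson (T - R) (U : Set (B H)) ≤ 2 * arveson T ((U : Set (B H)) + (M : Set (B H))) := by
  have hα := arveson_nonneg T ((U : Set (B H)) + (M : Set (B H)))
  refine arveson_le_of_norm_inner_le _ _ (by positivity) fun ξ η hη =>
    norm_inner_sub_le_of_mem_convexHull hα (fun p hp => ?_) hR
  refine norm_inner_le_arveson T (Set.mem_add.2 ⟨0, zero_mem U, 0, zero_mem M, add_zero 0⟩) ?_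
  rintro _ ⟨u, hu, m, hm, rfl⟩
  obtain ⟨j, k⟩ := p
  obtain ⟨hj, hk, -, hks, -, hk1, hjk⟩ := hp
  dsimp only at hj hk hks hk1 hjk ⊢
  have hmove : ∀ S : B H, ⟪η + k η, S (ξ - j ξ)⟫_ℂ = ⟪η, ((1 + k) * S * (1 - j)) ξ⟫_ℂ := by
    intro S
    have : ((1 + k) * S * (1 - j)) ξ = S (ξ - j ξ) + k (S (ξ - j ξ)) := rfl
    rw [this, inner_add_left, inner_add_right, inner_apply_left_of_isSelfAdjoint hks]
  have hm0 : (1 + k) * m * (1 - j) = 0 := by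
    rw [mul_assoc, mul_sub, mul_one, hjk m hm, add_mul, one_mul, mul_sub, ← mul_assoc, hk1, one_mul]
    abel
  rw [add_apply, inner_add_right, hmove, hmove, hm0,
    hη _ (hUbim _ (add_mem (one_mem D) hk) _ (sub_mem (one_mem D) hj) u hu)]
  simp

end Symmetrization

section Main

variable {H : Type*} [NormedAddCommGroup H] [InnerProductSpace ℂ H] [CompleteSpace H]
variable {D : StarSubalgebra ℂ (B H)} {M U : Submodule ℂ (B H)}

theorem infDist_add_le (hD : IsMasa D) (hUbim : IsBimodule D U)
    (hUcl : WStarClosed H (U : Set (B H))) (hMbim : IsBimodule D M)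
    (hMcl : WStarClosed H (M : Set (B H))) (hMter : IsTernary M) {k : ℝ}
    (hk : k ∈ hyperSet (U : Set (B H))) (T : B H) :
    Metric.infDist T ((U : Set (B H)) + (M : Set (B H))) ≤
      2 * k * arveson T ((U : Set (B H)) + (M : Set (B H))) := by
  obtain ⟨hk0, hk⟩ := hk
  have hα := arveson_nonneg T ((U : Set (B H)) + (M : Set (B H)))
  set α := arveson T ((U : Set (B H)) + (M : Set (B H)))
  refine le_of_forall_pos_le_add fun ε hε => ?_
  choose R hR hRs using exists_symmetrization (M := M) hD T
  have hu : ∀ s, ∃ u ∈ (U : Set (B H)), dist (T - R s) u < 2 * k * α + ε := by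
    intro s
    refine (Metric.infDist_lt_iff ⟨0, zero_mem U⟩).1 ?_
    have h := mul_le_mul_of_nonneg_left (arveson_sub_le hUbim (hR s)) hk0.le
    linarith [hk (T - R s)]
  choose u huU hu using hu
  have hRn : ∀ s, ‖R s‖ ≤ ‖T‖ := fun s => norm_le_of_mem_convexHull (hR s)
  have hun : ∀ s, ‖u s‖ ≤ 2 * k * α + ε + (‖T‖ + ‖T‖) := by
    intro s
    have h1 := norm_le_norm_add_norm_sub (T - R s) (u s)
    have h2 := hu s
    rw [dist_eq_norm] at h2
    linarith [norm_sub_le T (R s), hRn s]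
  let l : Ultrafilter (Finset (symmPairs D M)) := Ultrafilter.of atTop
  obtain ⟨R₀, hR₀⟩ := exists_weak_limit l hRn
  obtain ⟨u₀, hu₀⟩ := exists_weak_limit l hun
  have hu₀U : u₀ ∈ U := mem_of_weak_limit hUcl (l := (l : Filter _)) hun huU hu₀
  have hR₀M : R₀ ∈ M := by
    refine mem_of_intertwines_symmPairs hD hMbim hMcl hMter fun p hp => ?_
    ext ξ
    refine ext_inner_left ℂ fun η => ?_
    have h1 := hR₀ (p.1 ξ) η
    have h2 := hR₀ ξ (p.2 η)
    rw [inner_apply_left_of_isSelfAdjoint hp.2.2.2.1] at h2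
    refine tendsto_nhds_unique h1 (h2.congr' ?_)
    have hev : ∀ᶠ s in (l : Filter (Finset (symmPairs D M))), ⟨p, hp⟩ ∈ s :=
      Ultrafilter.of_le atTop ((eventually_ge_atTop {⟨p, hp⟩}).mono fun s hs => hs (by simp))
    filter_upwards [hev] with s hs
    rw [inner_apply_left_of_isSelfAdjoint hp.2.2.2.1]
    exact congrArg (fun A : B H => ⟪η, A ξ⟫_ℂ) (hRs s _ hs).symm
  have hdist : ‖T - R₀ - u₀‖ ≤ 2 * k * α + ε :=
    norm_le_of_weak_limit (l := (l : Filter _)) (T := fun s => T - R s - u s) (by positivity)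
      (fun s => by rw [← dist_eq_norm]; exact (hu s).le) fun ξ η => by
        simpa only [sub_apply, inner_sub_right] using
          (tendsto_const_nhds.sub (hR₀ ξ η)).sub (hu₀ ξ η)
  refine (Metric.infDist_le_dist_of_mem (Set.add_mem_add hu₀U hR₀M)).trans ?_
  have e : T - R₀ - u₀ = T - (u₀ + R₀) := by abel
  rw [e] at hdist
  rwa [dist_eq_norm]

end Main

/-- if `U` is a hyperreflexive weak* closed masa-bimodule and `M`
is a ternary masa-bimodule, then `U + M` is hyperreflexive and
`k(U + M) ≤ 2·k(U)`. -/
theorem stmt13 {H : Type*} [NormedAddCommGroup H] [InnerProductSpace ℂ H] [CompleteSpace H]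
    [TopologicalSpace.SeparableSpace H]
    (D : StarSubalgebra ℂ (B H)) (hD : IsMasa D)
    (U : Submodule ℂ (B H)) (hUbim : IsBimodule D U)
    (hUcl : WStarClosed H (U : Set (B H))) (hUhr : Hyperreflexive (U : Set (B H)))
    (M : Submodule ℂ (B H)) (hMbim : IsBimodule D M)
    (hMcl : WStarClosed H (M : Set (B H))) (hMter : IsTernary M) :
    Hyperreflexive ((U : Set (B H)) + (M : Set (B H))) ∧
    hyperConst ((U : Set (B H)) + (M : Set (B H))) ≤
      2 * hyperConst (U : Set (B H)) := by
  have hmem : ∀ k ∈ hyperSet (U : Set (B H)),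
      2 * k ∈ hyperSet ((U : Set (B H)) + (M : Set (B H))) := fun k hk =>
    ⟨mul_pos two_pos hk.1, fun T => infDist_add_le hD hUbim hUcl hMbim hMcl hMter hk T⟩
  refine ⟨hUhr.imp' (2 * ·) hmem, ?_⟩
  rw [← div_le_iff₀' two_pos]
  refine le_csInf hUhr fun k hk => ?_
  rw [div_le_iff₀' two_pos]
  exact csInf_le ⟨0, fun _ h => h.1.le⟩ (hmem k hk)
end
end

section
/- If U ⊆ B(H) is a hyperreflexive weak* closed masa-bimodule and M ⊆ B(H) is a ternary masa-bimodule, then U ∩ M is hyperreflexive and k(U ∩ M) ≤ 2 + 3·k(U). -/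
open scoped InnerProductSpace Pointwise

noncomputable section

open SchurHyper
open Filter Topology ComplexStarModule

namespace SchurHyper

section WeakLimits

variable {H : Type*} [NormedAddCommGroup H] [InnerProductSpace ℂ H]

/-- Convergence in the weak operator topology. -/
def WeakTendsto {ι : Type*} (S : ι → B H) (l : Filter ι) (R : B H) : Prop :=
  ∀ x y : H, Tendsto (fun i => ⟪y, S i x⟫_ℂ) l (𝓝 ⟪y, R x⟫_ℂ)

lemma WeakTendsto.norm_le {ι : Type*} {S : ι → B H} {l : Filter ι} [l.NeBot] {R : B H}
    (h : WeakTendsto S l R) {c : ℝ} (hc : ∀ i, ‖S i‖ ≤ c) : ‖R‖ ≤ c := by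
  have hc0 : 0 ≤ c := by
    obtain ⟨i⟩ := l.nonempty_of_neBot
    exact (norm_nonneg _).trans (hc i)
  refine R.opNorm_le_bound hc0 fun x => ?_
  have hle : ‖⟪R x, R x⟫_ℂ‖ ≤ c * ‖x‖ * ‖R x‖ := by
    refine le_of_tendsto (h x (R x)).norm (Eventually.of_forall fun i => ?_)
    calc ‖⟪R x, S i x⟫_ℂ‖ ≤ ‖R x‖ * ‖S i x‖ := norm_inner_le_norm _ _
      _ ≤ ‖R x‖ * (c * ‖x‖) := by
        gcongr
        exact (S i).le_of_opNorm_le (hc i) x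
      _ = _ := by ring
  rw [inner_self_eq_norm_sq_to_K] at hle
  have h2 : ‖R x‖ * ‖R x‖ ≤ c * ‖x‖ * ‖R x‖ := by
    simpa [sq] using hle
  rcases eq_or_ne (R x) 0 with h0 | h0
  · rw [h0, norm_zero]; positivity
  · exact le_of_mul_le_mul_right h2 (norm_pos_iff.mpr h0)

lemma WeakTendsto.const_sub {ι : Type*} {S : ι → B H} {l : Filter ι} {R : B H}
    (h : WeakTendsto S l R) (T : B H) : WeakTendsto (fun i => T - S i) l (T - R) := by
  intro x y
  simpa [inner_sub_right] using (tendsto_const_nhds (x := ⟪y, T x⟫_ℂ)).sub (h x y)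

lemma WeakTendsto.unique {ι : Type*} {S : ι → B H} {l : Filter ι} [l.NeBot] {R R' : B H}
    (h : WeakTendsto S l R) (h' : WeakTendsto S l R') : R = R' := by
  ext x
  exact ext_inner_left ℂ fun y => tendsto_nhds_unique (h x y) (h' x y)

lemma WeakTendsto.congr' {ι : Type*} {S S' : ι → B H} {l : Filter ι} {R : B H}
    (h : WeakTendsto S l R) (he : S =ᶠ[l] S') : WeakTendsto S' l R := fun x y =>
  (h x y).congr' (he.mono fun i hi => by simp [hi])

lemma WeakTendsto.mem_of_wStarClosed {ι : Type*} {S : ι → B H} {l : Filter ι} [l.NeBot] {R : B H}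
    (h : WeakTendsto S l R) {c : ℝ} (hc : ∀ i, ‖S i‖ ≤ c) {X : Set (B H)}
    (hX : WStarClosed H X) (hS : ∀ i, S i ∈ X) : R ∈ X := by
  refine @IsClosed.mem_of_tendsto _ (weakStarTopology H) ι R X S l _ hX ?_ (Eventually.of_forall hS)
  rw [weakStarTopology, nhds_induced, tendsto_comap_iff, tendsto_pi_nhds]
  rintro ⟨ω, x, y, hx, hy, hω⟩
  simp only [Function.comp_def, hω]
  refine tendsto_tsum_of_dominated_convergence
    (bound := fun n => c * ((‖x n‖ ^ 2 + ‖y n‖ ^ 2) / 2)) (((hx.add hy).div_const 2).mul_left c)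
    (fun n => h (x n) (y n)) (Eventually.of_forall fun i n => ?_)
  have hc0 : 0 ≤ c := (norm_nonneg _).trans (hc i)
  calc ‖⟪y n, S i (x n)⟫_ℂ‖ ≤ ‖y n‖ * ‖S i (x n)‖ := norm_inner_le_norm _ _
    _ ≤ ‖y n‖ * (c * ‖x n‖) := by
      gcongr
      exact (S i).le_of_opNorm_le (hc i) _
    _ = c * (‖x n‖ * ‖y n‖) := by ring
    _ ≤ _ := by
      gcongr
      nlinarith [sq_nonneg (‖x n‖ - ‖y n‖)]

variable [CompleteSpace H]

lemma WeakTendsto.mul_mul {ι : Type*} {S : ι → B H} {l : Filter ι} {R : B H}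
    (h : WeakTendsto S l R) (A C : B H) : WeakTendsto (fun i => A * S i * C) l (A * R * C) := by
  intro x y
  simpa [ContinuousLinearMap.adjoint_inner_left] using h (C x) (ContinuousLinearMap.adjoint A y)

lemma exists_weakTendsto {ι : Type*} (u : Ultrafilter ι) {S : ι → B H} {c : ℝ}
    (hc : ∀ i, ‖S i‖ ≤ c) : ∃ R : B H, WeakTendsto S u R := by
  have hb (i : ι) (x y : H) : ‖⟪S i x, y⟫_ℂ‖ ≤ c * ‖x‖ * ‖y‖ :=
    (norm_inner_le_norm _ _).trans (by gcongr; exact (S i).le_of_opNorm_le (hc i) x)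
  have hlim (x y : H) : ∃ z : ℂ, Tendsto (fun i => ⟪S i x, y⟫_ℂ) u (𝓝 z) := by
    obtain ⟨z, -, hz⟩ := (isCompact_closedBall (0 : ℂ) (c * ‖x‖ * ‖y‖)).ultrafilter_le_nhds
      (u.map fun i => ⟪S i x, y⟫_ℂ) (by
        rw [le_principal_iff, Ultrafilter.mem_coe, Ultrafilter.mem_map]
        exact univ_mem' fun i => by simpa using hb i x y)
    exact ⟨z, hz⟩
  choose L hL using hlim
  let form : H →L⋆[ℂ] H →L[ℂ] ℂ := LinearMap.mkContinuous₂
    (LinearMap.mk₂'ₛₗ (starRingEnd ℂ) (RingHom.id ℂ) L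
      (fun x x' y => tendsto_nhds_unique (hL _ _)
        (by simpa [inner_add_left] using (hL x y).add (hL x' y)))
      (fun a x y => tendsto_nhds_unique (hL _ _)
        (by simpa [inner_smul_left, mul_comm] using (hL x y).const_mul (starRingEnd ℂ a)))
      (fun x y y' => tendsto_nhds_unique (hL _ _)
        (by simpa [inner_add_right] using (hL x y).add (hL x y')))
      (fun a x y => tendsto_nhds_unique (hL _ _)
        (by simpa [inner_smul_right] using (hL x y).const_mul a))) c
    (fun x y => le_of_tendsto (hL x y).norm (Eventually.of_forall fun i => hb i x y))
  refine ⟨InnerProductSpace.continuousLinearMapOfBilin form, fun x y => ?_⟩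
  have key : ⟪InnerProductSpace.continuousLinearMapOfBilin form x, y⟫_ℂ = L x y :=
    InnerProductSpace.continuousLinearMapOfBilin_apply form x y
  have := (hL x y).star
  rw [← key] at this
  simpa only [← starRingEnd_apply, inner_conj_symm] using this

end WeakLimits

section Amplification

variable {H : Type*} [NormedAddCommGroup H] [InnerProductSpace ℂ H] {ι : Type*}

/-- The amplification of an operator to the Hilbert sum of copies of `H` indexed by `ι`. -/
def ampl (ι : Type*) (A : B H) : B (lp (fun _ : ι => H) 2) :=
  LinearMap.mkContinuous
    { toFun := fun x => ⟨fun i => A (x i), ((lp.memℓp x).norm.const_mul ‖A‖).mono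
        fun i => A.le_opNorm (x i)⟩
      map_add' := fun x y => Subtype.ext (funext fun i => map_add A (x i) (y i))
      map_smul' := fun a x => Subtype.ext (funext fun i => map_smul A a (x i)) } ‖A‖ fun x => by
    refine (lp.norm_mono (p := 2) (by norm_num) (y := (‖A‖ : ℂ) • x) fun i => ?_).trans
      ((norm_smul_le _ _).trans (by simp))
    rw [lp.coeFn_smul, Pi.smul_apply, norm_smul, Complex.norm_real, norm_norm]
    exact A.le_opNorm (x i)

@[simp] lemma ampl_apply (A : B H) (x : lp (fun _ : ι => H) 2) (i : ι) :
    ampl ι A x i = A (x i) := rfl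

lemma ampl_mul (A C : B H) (x : lp (fun _ : ι => H) 2) :
    ampl ι (A * C) x = ampl ι A (ampl ι C x) := by
  ext i; simp

lemma ampl_single [DecidableEq ι] (A : B H) (j : ι) (h : H) :
    ampl ι A (lp.single 2 j h) = lp.single 2 j (A h) := by
  ext i
  rcases eq_or_ne i j with rfl | hij
  · simp
  · simp [hij]

lemma inner_ampl [CompleteSpace H] (A : B H) (x y : lp (fun _ : ι => H) 2) :
    ⟪y, ampl ι A x⟫_ℂ = ⟪ampl ι (star A) y, x⟫_ℂ := by
  simp only [lp.inner_eq_tsum, ampl_apply, ContinuousLinearMap.star_eq_adjoint,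
    ContinuousLinearMap.adjoint_inner_left]

lemma starProjection_intertwines {K : Type*} [NormedAddCommGroup K] [InnerProductSpace ℂ K]
    {V W : Submodule ℂ K} [V.HasOrthogonalProjection] [W.HasOrthogonalProjection] {A A' : K → K}
    (hA : ∀ x y, A (x + y) = A x + A y) (hadj : ∀ x y, ⟪y, A x⟫_ℂ = ⟪A' y, x⟫_ℂ)
    (hVW : ∀ x ∈ V, A x ∈ W) (hWV : ∀ y ∈ W, A' y ∈ V) (x : K) :
    W.starProjection (A x) = A (V.starProjection x) := by
  refine Submodule.eq_starProjection_of_mem_orthogonal' (z := A (x - V.starProjection x))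
    (hVW _ (V.starProjection_apply_mem x)) ?_ ?_
  · intro w hw
    rw [hadj]
    exact V.sub_starProjection_mem_orthogonal x _ (hWV w hw)
  · rw [← hA]; simp

variable [DecidableEq ι]

/-- The matrix entries of an operator on a Hilbert sum of copies of `H`. -/
def entry (P : B (lp (fun _ : ι => H) 2)) (i j : ι) : B H :=
  (lp.evalCLM ℂ (fun _ : ι => H) 2 i).comp
    (P.comp (lp.singleContinuousLinearMap ℂ (fun _ : ι => H) 2 j))

@[simp] lemma entry_apply (P : B (lp (fun _ : ι => H) 2)) (i j : ι) (h : H) :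
    entry P i j h = P (lp.single 2 j h) i := rfl

lemma ext_entry {P Q : B (lp (fun _ : ι => H) 2)} (h : ∀ i j, entry P i j = entry Q i j) :
    P = Q := by
  ext1 x
  have hs := lp.hasSum_single (p := 2) ENNReal.ofNat_ne_top x
  refine (P.hasSum hs).unique ?_
  convert Q.hasSum hs using 2 with j
  ext i
  exact congr($(h i j) (x j))

lemma entry_ampl_mul (A : B H) (P : B (lp (fun _ : ι => H) 2)) (i j : ι) :
    entry (ampl ι A * P) i j = A * entry P i j := rfl

lemma entry_mul_ampl (A : B H) (P : B (lp (fun _ : ι => H) 2)) (i j : ι) :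
    entry (P * ampl ι A) i j = entry P i j * A := by
  ext h
  simp [ampl_single]

lemma star_entry_starProjection [CompleteSpace H] (V : Submodule ℂ (lp (fun _ : ι => H) 2))
    [V.HasOrthogonalProjection] (i j : ι) :
    star (entry V.starProjection i j) = entry V.starProjection j i := by
  rw [ContinuousLinearMap.star_eq_adjoint, eq_comm, ContinuousLinearMap.eq_adjoint_iff]
  intro x y
  simp only [entry_apply]
  exact (lp.inner_single_right (𝕜 := ℂ) j y (V.starProjection (lp.single 2 i x))).symm.trans
    ((V.inner_starProjection_left_eq_right _ _).trans
      (lp.inner_single_left (𝕜 := ℂ) i x (V.starProjection (lp.single 2 j y))))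

end Amplification

section Intertwiners

variable {H : Type*} [NormedAddCommGroup H] [InnerProductSpace ℂ H] [CompleteSpace H]

/-- The pairs of elements of `D` that intertwine every element of `M`, together with their
adjoints. -/
def intertwiners (D : StarSubalgebra ℂ (B H)) (M : Set (B H)) :
    StarSubalgebra ℂ (B H × B H) where
  carrier := {p | p.1 ∈ D ∧ p.2 ∈ D ∧
    ∀ X ∈ M, p.1 * X = X * p.2 ∧ star p.1 * X = X * star p.2}
  mul_mem' := by
    rintro p q ⟨hp1, hp2, hp⟩ ⟨hq1, hq2, hq⟩
    refine ⟨mul_mem hp1 hq1, mul_mem hp2 hq2, fun X hX => ⟨?_, ?_⟩⟩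
    · rw [Prod.fst_mul, Prod.snd_mul, mul_assoc, (hq X hX).1, ← mul_assoc, (hp X hX).1, mul_assoc]
    · rw [Prod.fst_mul, Prod.snd_mul, star_mul, star_mul, mul_assoc, (hp X hX).2, ← mul_assoc,
        (hq X hX).2, mul_assoc]
  add_mem' := by
    rintro p q ⟨hp1, hp2, hp⟩ ⟨hq1, hq2, hq⟩
    refine ⟨add_mem hp1 hq1, add_mem hp2 hq2, fun X hX => ⟨?_, ?_⟩⟩
    · rw [Prod.fst_add, Prod.snd_add, add_mul, mul_add, (hp X hX).1, (hq X hX).1]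
    · rw [Prod.fst_add, Prod.snd_add, star_add, star_add, add_mul, mul_add, (hp X hX).2,
        (hq X hX).2]
  algebraMap_mem' r := by
    refine ⟨algebraMap_mem D r, algebraMap_mem D r, fun X _ => ⟨?_, ?_⟩⟩
    · exact Algebra.commutes r X
    · simp only [Prod.algebraMap_apply, ← algebraMap_star_comm]
      exact Algebra.commutes _ X
  star_mem' := by
    rintro p ⟨hp1, hp2, hp⟩
    refine ⟨star_mem hp1, star_mem hp2, fun X hX => ⟨(hp X hX).2, ?_⟩⟩
    simpa using (hp X hX).1

lemma mem_intertwiners {D : StarSubalgebra ℂ (B H)} {M : Set (B H)} {p : B H × B H} :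
    p ∈ intertwiners D M ↔ p.1 ∈ D ∧ p.2 ∈ D ∧
      ∀ X ∈ M, p.1 * X = X * p.2 ∧ star p.1 * X = X * star p.2 := Iff.rfl

lemma IsMasa.mem_iff {D : StarSubalgebra ℂ (B H)} (hD : IsMasa D) {T : B H} :
    T ∈ D ↔ ∀ A ∈ D, T * A = A * T :=
  ⟨fun hT A hA => hD.1 T hT A hA, hD.2 T⟩

lemma IsMasa.isClosed {D : StarSubalgebra ℂ (B H)} (hD : IsMasa D) :
    IsClosed (D : Set (B H)) := by
  have : (D : Set (B H)) = ⋂ A ∈ D, {T | T * A = A * T} := by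
    ext T
    simp only [SetLike.mem_coe, Set.mem_iInter, Set.mem_ofPred_eq]
    exact hD.mem_iff
  rw [this]
  exact isClosed_biInter fun A _ => isClosed_eq (by fun_prop) (by fun_prop)

lemma isClosed_intertwiners {D : StarSubalgebra ℂ (B H)} (hD : IsMasa D) (M : Set (B H)) :
    IsClosed (intertwiners D M : Set (B H × B H)) := by
  have : (intertwiners D M : Set (B H × B H)) = Prod.fst ⁻¹' D ∩ Prod.snd ⁻¹' D ∩
      ⋂ X ∈ M, {p | p.1 * X = X * p.2} ∩ {p | star p.1 * X = X * star p.2} := by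
    ext p; simp [mem_intertwiners, and_assoc]
  rw [this]
  refine ((hD.isClosed.preimage continuous_fst).inter (hD.isClosed.preimage continuous_snd)).inter
    (isClosed_biInter fun X _ => ?_)
  exact (isClosed_eq (by fun_prop) (by fun_prop)).inter (isClosed_eq (by fun_prop) (by fun_prop))

/-- The projection onto the closure of the range of an operator. -/
def rangeProj (a : B H) : B H := a.range.topologicalClosure.starProjection

lemma rangeProj_intertwines {a c X : B H} (h : a * X = X * c) (h' : c * star X = star X * a) :
    rangeProj a * X = X * rangeProj c := by
  have maps {a c X : B H} (h : a * X = X * c) :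
      ∀ x ∈ c.range.topologicalClosure, X x ∈ a.range.topologicalClosure := by
    intro x hx
    refine map_mem_closure X.continuous hx ?_
    rintro _ ⟨y, rfl⟩
    exact ⟨X y, congr($h y)⟩
  ext x
  exact starProjection_intertwines (A := X) (A' := (star X : B H)) (map_add X)
    (fun x y => (ContinuousLinearMap.adjoint_inner_left X x y).symm) (maps h) (maps h') x

lemma rangeProj_mul_self (a : B H) : rangeProj a * a = a := by
  ext x
  exact Submodule.starProjection_eq_self_iff.mpr (subset_closure ⟨x, rfl⟩)

lemma rangeProj_mul_eq_zero {a b : B H} (ha : IsSelfAdjoint a) (hab : a * b = 0) :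
    rangeProj a * b = 0 := by
  ext x
  refine (Submodule.starProjection_apply_eq_zero_iff _).mpr ?_
  rw [Submodule.orthogonal_closure, Submodule.mem_orthogonal]
  rintro _ ⟨y, rfl⟩
  have : ⟪a y, b x⟫_ℂ = ⟪y, (a * b) x⟫_ℂ := by
    conv_lhs => rw [← ha.star_eq, ContinuousLinearMap.star_eq_adjoint,
      ContinuousLinearMap.adjoint_inner_left]
    rfl
  simpa [hab] using this

lemma isSelfAdjoint_rangeProj (a : B H) : IsSelfAdjoint (rangeProj a) :=
  isSelfAdjoint_starProjection _

lemma isIdempotentElem_rangeProj (a : B H) : rangeProj a * rangeProj a = rangeProj a :=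
  Submodule.isIdempotentElem_starProjection _

lemma IsMasa.rangeProj_mem {D : StarSubalgebra ℂ (B H)} (hD : IsMasa D) {a : B H} (ha : a ∈ D) :
    rangeProj a ∈ D :=
  hD.2 _ fun A hA => rangeProj_intertwines (hD.1 a ha A hA) (hD.1 a ha _ (star_mem hA))

lemma exists_sign {D : StarSubalgebra ℂ (B H)} (hD : IsMasa D) {M : Set (B H)} {p : B H × B H}
    (hp : p ∈ intertwiners D M) (hsa : IsSelfAdjoint p) :
    ∃ s ∈ intertwiners D M, IsSelfAdjoint s ∧ s * s = 1 ∧ s * p = p⁺ + p⁻ := by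
  have : IsClosed (intertwiners D M : Set (B H × B H)) := isClosed_intertwiners hD M
  have hpos : p⁺ ∈ intertwiners D M := by
    rw [CFC.posPart_def]
    exact cfcₙ_mem _ hp
  have hposa : IsSelfAdjoint p⁺ := (CFC.posPart_nonneg p).isSelfAdjoint
  have ha1 : star p⁺.1 = p⁺.1 := congr_arg Prod.fst hposa.star_eq
  have ha2 : star p⁺.2 = p⁺.2 := congr_arg Prod.snd hposa.star_eq
  set e : B H × B H := (rangeProj p⁺.1, rangeProj p⁺.2) with he
  have hesa : IsSelfAdjoint e :=
    Prod.ext (isSelfAdjoint_rangeProj p⁺.1).star_eq (isSelfAdjoint_rangeProj p⁺.2).star_eq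
  have hee : e * e = e :=
    Prod.ext (isIdempotentElem_rangeProj p⁺.1) (isIdempotentElem_rangeProj p⁺.2)
  have hep : e * p⁺ = p⁺ := Prod.ext (rangeProj_mul_self p⁺.1) (rangeProj_mul_self p⁺.2)
  have hen : e * p⁻ = 0 := by
    have h0 := CFC.posPart_mul_negPart p
    exact Prod.ext (rangeProj_mul_eq_zero ha1 congr(Prod.fst $h0))
      (rangeProj_mul_eq_zero ha2 congr(Prod.snd $h0))
  have hemem : e ∈ intertwiners D M := by
    refine ⟨hD.rangeProj_mem hpos.1, hD.rangeProj_mem hpos.2.1, fun X hX => ?_⟩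
    have hX' : e.1 * X = X * e.2 := by
      refine rangeProj_intertwines (hpos.2.2 X hX).1 ?_
      have := congr_arg star (hpos.2.2 X hX).1
      rw [star_mul, star_mul, ha1, ha2] at this
      exact this.symm
    refine ⟨hX', ?_⟩
    rwa [(isSelfAdjoint_rangeProj p⁺.1).star_eq, (isSelfAdjoint_rangeProj p⁺.2).star_eq]
  refine ⟨e + e - 1, sub_mem (add_mem hemem hemem) (one_mem _),
    (hesa.add hesa).sub (IsSelfAdjoint.one _), ?_, ?_⟩
  · simp only [sub_mul, mul_sub, add_mul, mul_add, hee, one_mul, mul_one]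
    abel
  · conv_lhs => rw [← CFC.posPart_sub_negPart p hsa]
    simp only [sub_mul, mul_sub, add_mul, hep, hen, one_mul]
    abel

lemma norm_symmetry_le {A : Type*} [CStarAlgebra A] {s : A} (hs : IsSelfAdjoint s)
    (hss : s * s = 1) : ‖s‖ ≤ 1 := by
  have hone : ‖(1 : A)‖ ≤ 1 := by
    nontriviality A
    simp
  have := CStarRing.norm_star_mul_self (x := s)
  rw [hs.star_eq, hss] at this
  nlinarith [norm_nonneg s]

lemma norm_two_smul_sub_le {A : Type*} [CStarAlgebra A] [PartialOrder A] [StarOrderedRing A]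
    {p s : A} (hs : IsSelfAdjoint s) (hss : s * s = 1) (hsp : 0 ≤ s * p) (hp : ‖p‖ ≤ 1) :
    ‖p + p - s‖ ≤ 1 := by
  have hone : ‖(1 : A)‖ ≤ 1 := by
    nontriviality A
    simp
  have hs1 : ‖s‖ ≤ 1 := norm_symmetry_le hs hss
  set a := s * p with ha
  have han : ‖a‖ ≤ 1 := (norm_mul_le _ _).trans (mul_le_one₀ hs1 (norm_nonneg _) hp)
  have heq : p + p - s = s * (a + a - 1) := by
    simp only [ha, mul_sub, mul_add, ← mul_assoc, hss, one_mul, mul_one]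
  have hb : ‖a + a - 1‖ ≤ 1 := by
    have hcfc : a + a - 1 = cfc (fun x : ℝ => x + x - 1) a := by
      rw [cfc_sub .., cfc_add .., cfc_id' ℝ a, cfc_const_one ℝ a]
    rw [hcfc]
    refine norm_cfc_le zero_le_one fun x hx => ?_
    have h0 : 0 ≤ x := spectrum_nonneg_of_nonneg hsp hx
    have h1 : x ≤ 1 := (le_abs_self x).trans
      ((spectrum.norm_le_norm_mul_of_mem hx).trans (mul_le_one₀ han (norm_nonneg _) hone))
    rw [Real.norm_eq_abs, abs_le]
    constructor <;> linarith
  rw [heq]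
  exact (norm_mul_le _ _).trans (mul_le_one₀ hs1 (norm_nonneg _) hb)

lemma intertwines_of_symmetries {D : StarSubalgebra ℂ (B H)} (hD : IsMasa D) {M : Set (B H)}
    {T : B H} (hT : ∀ s ∈ intertwiners D M, IsSelfAdjoint s → s * s = 1 → s.1 * T = T * s.2)
    {p : B H × B H} (hp : p ∈ intertwiners D M) : p.1 * T = T * p.2 := by
  have halving (n : ℕ) : ∀ p ∈ intertwiners D M, IsSelfAdjoint p → ‖p‖ ≤ 1 →
      ‖p.1 * T - T * p.2‖ ≤ 2 * ‖T‖ * (1 / 2) ^ n := by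
    induction n with
    | zero =>
      intro p _ _ hn
      have h1 : ‖p.1‖ ≤ 1 := (norm_fst_le p).trans hn
      have h2 : ‖p.2‖ ≤ 1 := (norm_snd_le p).trans hn
      calc ‖p.1 * T - T * p.2‖ ≤ ‖p.1‖ * ‖T‖ + ‖T‖ * ‖p.2‖ :=
            (norm_sub_le _ _).trans (add_le_add (norm_mul_le _ _) (norm_mul_le _ _))
        _ ≤ 1 * ‖T‖ + ‖T‖ * 1 := by gcongr
        _ = _ := by ring
    | succ n ih =>
      intro p hp hsa hn
      obtain ⟨s, hs, hssa, hss, hsp⟩ := exists_sign hD hp hsa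
      have hle := ih (p + p - s) (sub_mem (add_mem hp hp) hs) ((hsa.add hsa).sub hssa)
        (norm_two_smul_sub_le hssa hss
          (hsp ▸ add_nonneg (CFC.posPart_nonneg p) (CFC.negPart_nonneg p)) hn)
      have heq : (p + p - s).1 * T - T * (p + p - s).2 = (2 : ℂ) • (p.1 * T - T * p.2) := by
        have := hT s hs hssa hss
        simp only [Prod.fst_sub, Prod.snd_sub, Prod.fst_add, Prod.snd_add, sub_mul, mul_sub,
          add_mul, mul_add, this, two_smul]
        abel
      rw [heq, norm_smul, Complex.norm_ofNat] at hle
      rw [pow_succ]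
      linarith
  have contraction : ∀ p ∈ intertwiners D M, IsSelfAdjoint p → ‖p‖ ≤ 1 → p.1 * T = T * p.2 := by
    intro p hp hsa hn
    have hlim : Tendsto (fun n : ℕ => 2 * ‖T‖ * (1 / 2 : ℝ) ^ n) atTop (𝓝 0) := by
      simpa using (tendsto_pow_atTop_nhds_zero_of_lt_one (r := (1 / 2 : ℝ)) (by norm_num)
        (by norm_num)).const_mul (2 * ‖T‖)
    have := ge_of_tendsto' hlim fun n => halving n p hp hsa hn
    exact sub_eq_zero.mp (norm_le_zero_iff.mp this)
  have smul_mem {r : ℝ} {p : B H × B H} (hp : p ∈ intertwiners D M) :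
      r • p ∈ intertwiners D M := by
    rw [← Complex.coe_smul]
    exact (intertwiners D M).smul_mem hp (r : ℂ)
  have selfAdjoint : ∀ p ∈ intertwiners D M, IsSelfAdjoint p → p.1 * T = T * p.2 := by
    intro p hp hsa
    have hpos : 0 < ‖p‖ + 1 := by positivity
    have h := contraction ((‖p‖ + 1)⁻¹ • p) (smul_mem hp)
      ((IsSelfAdjoint.all (‖p‖ + 1)⁻¹).smul hsa) (by
        rw [norm_smul, norm_inv, Real.norm_of_nonneg hpos.le, inv_mul_le_one₀ hpos]
        linarith)
    rw [Prod.smul_fst, Prod.smul_snd, smul_mul_assoc, mul_smul_comm] at h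
    exact smul_right_injective _ (inv_pos.mpr hpos).ne' h
  have hre : (ℜ p : B H × B H) ∈ intertwiners D M := by
    rw [realPart_apply_coe]
    exact smul_mem (add_mem hp (star_mem hp))
  have him : (ℑ p : B H × B H) ∈ intertwiners D M := by
    rw [imaginaryPart_apply_coe]
    exact (intertwiners D M).smul_mem (smul_mem (sub_mem hp (star_mem hp))) _
  have h1 := selfAdjoint _ hre (ℜ p).2
  have h2 := selfAdjoint _ him (ℑ p).2
  rw [← realPart_add_I_smul_imaginaryPart p]
  simp only [Prod.fst_add, Prod.snd_add, Prod.smul_fst, Prod.smul_snd, add_mul, mul_add,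
    smul_mul_assoc, mul_smul_comm, h1, h2]

end Intertwiners

section Density

variable {H : Type*} [NormedAddCommGroup H] [InnerProductSpace ℂ H] [CompleteSpace H]

/-- Every operator intertwining the intertwiners of a ternary masa-bimodule `M` can be approximated
by elements of `M` on a given square-summable family of vectors. -/
lemma ampl_mem_closure {D : StarSubalgebra ℂ (B H)} (hD : IsMasa D) {M : Submodule ℂ (B H)}
    (hMbim : IsBimodule D M) (hMter : IsTernary M) {T : B H}
    (hT : ∀ p ∈ intertwiners D M, p.1 * T = T * p.2) {ι : Type*} (x : lp (fun _ : ι => H) 2) :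
    ampl ι T x ∈ closure ((fun m => ampl ι m x) '' (M : Set (B H))) := by
  classical
  have mul_mem_left {A X : B H} (hA : A ∈ D) (hX : X ∈ M) : A * X ∈ M := by
    simpa using hMbim A hA 1 (one_mem D) X hX
  have mul_mem_right {A X : B H} (hA : A ∈ D) (hX : X ∈ M) : X * A ∈ M := by
    simpa using hMbim 1 (one_mem D) A hA X hX
  let evalx : B H →ₗ[ℂ] lp (fun _ : ι => H) 2 :=
    { toFun := fun m => ampl ι m x
      map_add' := fun m m' => by ext i; rfl
      map_smul' := fun a m => by ext i; rfl }
  let L : Submodule ℂ (lp (fun _ : ι => H) 2) := (M.map evalx).topologicalClosure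
  let N : Submodule ℂ (lp (fun _ : ι => H) 2) := ⨅ m : M, L.comap (ampl ι (m : B H)).toLinearMap
  have mem_N {z : lp (fun _ : ι => H) 2} : z ∈ N ↔ ∀ m ∈ M, ampl ι m z ∈ L := by
    simp [N, Submodule.mem_iInf]
  have hLcl : IsClosed (L : Set (lp (fun _ : ι => H) 2)) := Submodule.isClosed_topologicalClosure _
  have hNcl : IsClosed (N : Set (lp (fun _ : ι => H) 2)) := by
    have : (N : Set (lp (fun _ : ι => H) 2)) = ⋂ m ∈ M, ampl ι m ⁻¹' L := by
      ext z
      simp only [SetLike.mem_coe, mem_N, Set.mem_iInter, Set.mem_preimage]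
    rw [this]
    exact isClosed_biInter fun m _ => hLcl.preimage (ampl ι m).continuous
  have : CompleteSpace L := hLcl.completeSpace_coe
  have : CompleteSpace N := hNcl.completeSpace_coe
  have map_L {A : B H} {V : Submodule ℂ (lp (fun _ : ι => H) 2)}
      (hV : IsClosed (V : Set (lp (fun _ : ι => H) 2))) (hA : ∀ m ∈ M, ampl ι (A * m) x ∈ V) :
      ∀ z ∈ L, ampl ι A z ∈ V := by
    have hle : L ≤ V.comap (ampl ι A).toLinearMap := by
      refine Submodule.topologicalClosure_minimal _ ?_ (hV.preimage (ampl ι A).continuous)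
      rintro _ ⟨m, hm, rfl⟩
      have := hA m hm
      rw [ampl_mul] at this
      exact this
    exact hle
  have memL {m : B H} (hm : m ∈ M) : ampl ι m x ∈ L := subset_closure ⟨m, hm, rfl⟩
  have hxN : x ∈ N := mem_N.mpr fun m hm => memL hm
  have hMN : ∀ m ∈ M, ∀ z ∈ N, ampl ι m z ∈ L := fun m hm z hz => mem_N.mp hz m hm
  have hML : ∀ m ∈ M, ∀ z ∈ L, ampl ι (star m) z ∈ N := fun m hm =>
    map_L hNcl fun m' hm' => mem_N.mpr fun m'' hm'' => by
      rw [← ampl_mul, ← mul_assoc]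
      exact memL (hMter m'' hm'' m hm m' hm')
  have hDL : ∀ A ∈ D, ∀ z ∈ L, ampl ι A z ∈ L := fun A hA =>
    map_L hLcl fun m hm => memL (mul_mem_left hA hm)
  have hDN : ∀ A ∈ D, ∀ z ∈ N, ampl ι A z ∈ N := fun A hA z hz => mem_N.mpr fun m hm => by
    rw [← ampl_mul]
    exact mem_N.mp hz _ (mul_mem_right hA hm)
  have intertwine {V W : Submodule ℂ (lp (fun _ : ι => H) 2)} [V.HasOrthogonalProjection]
      [W.HasOrthogonalProjection] {A : B H} (hVW : ∀ z ∈ V, ampl ι A z ∈ W)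
      (hWV : ∀ z ∈ W, ampl ι (star A) z ∈ V) (i j : ι) :
      entry W.starProjection i j * A = A * entry V.starProjection i j := by
    rw [← entry_mul_ampl, ← entry_ampl_mul]
    congr 1
    ext1 z
    exact starProjection_intertwines (map_add _) (inner_ampl A) hVW hWV z
  have hentry (i j : ι) :
      (entry L.starProjection i j, entry N.starProjection i j) ∈ intertwiners D M := by
    refine ⟨hD.2 _ fun A hA => intertwine (hDL A hA) (hDL _ (star_mem hA)) i j,
      hD.2 _ fun A hA => intertwine (hDN A hA) (hDN _ (star_mem hA)) i j, fun m hm => ⟨?_, ?_⟩⟩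
    · exact intertwine (hMN m hm) (hML m hm) i j
    · simp only [star_entry_starProjection]
      exact intertwine (hMN m hm) (hML m hm) j i
  have hTP : L.starProjection * ampl ι T = ampl ι T * N.starProjection := ext_entry fun i j => by
    rw [entry_mul_ampl, entry_ampl_mul]
    exact hT _ (hentry i j)
  have hfix : L.starProjection (ampl ι T x) = ampl ι T x := by
    have := congr($hTP x)
    simpa [N.starProjection_eq_self_iff.mpr hxN] using this
  have hmem : ampl ι T x ∈ L := L.starProjection_eq_self_iff.mp hfix
  exact hmem

/-- A weak* closed ternary masa-bimodule is determined by its intertwiners. -/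
theorem mem_of_intertwines {D : StarSubalgebra ℂ (B H)} (hD : IsMasa D) {M : Submodule ℂ (B H)}
    (hMbim : IsBimodule D M) (hMcl : WStarClosed H (M : Set (B H))) (hMter : IsTernary M) {T : B H}
    (hT : ∀ p ∈ intertwiners D M, p.1 * T = T * p.2) : T ∈ M := by
  classical
  by_contra hTM
  obtain ⟨V, hV, hVM⟩ :=
    isOpen_induced_iff.mp (@IsClosed.isOpen_compl _ (weakStarTopology H) _ hMcl)
  obtain ⟨I, u, hu, huV⟩ := isOpen_pi_iff.mp hV _ (hVM.symm.subset hTM)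
  choose x y hx hy hω using fun ω : {ω : B H →ₗ[ℂ] ℂ // IsNormalFunctional H ω} => ω.2
  have hmem {ι : Type _} (f : ι → H) (hf : Summable fun i => ‖f i‖ ^ 2) : Memℓp f 2 :=
    memℓp_gen (by simpa using hf)
  let xI : lp (fun _ : I × ℕ => H) 2 := ⟨fun q => x q.1 q.2, hmem _ <| by
    refine (summable_prod_of_nonneg fun _ => by positivity).mpr ⟨fun i => hx i, ?_⟩
    exact (hasSum_fintype _).summable⟩
  let yI (i : I) : lp (fun _ : I × ℕ => H) 2 :=
    ⟨fun q => if q.1 = i then y q.1 q.2 else 0, hmem _ <| by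
      refine (summable_prod_of_nonneg fun _ => by positivity).mpr ⟨fun j => ?_, ?_⟩
      · by_cases hj : j = i
        · simpa [hj] using hy i
        · simp [hj]
      · exact (hasSum_fintype _).summable⟩
  have hinner (i : I) (m : B H) : ⟪yI i, ampl (I × ℕ) m xI⟫_ℂ = i.1.1 m := by
    rw [hω, lp.inner_eq_tsum, ← (Prod.mk_right_injective i).tsum_eq]
    · refine tsum_congr fun n => ?_
      simp [xI, yI]
    · rintro ⟨j, n⟩ hq
      have hj : j = i := by
        by_contra hj
        exact hq (by simp [yI, hj])
      exact ⟨n, by rw [hj]⟩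
  let O : Set (lp (fun _ : I × ℕ => H) 2) := ⋂ i : I, {z | ⟪yI i, z⟫_ℂ ∈ u i.1}
  have hO : IsOpen O := isOpen_iInter_of_finite fun i =>
    (hu i.1 i.2).1.preimage (by fun_prop : Continuous fun z => ⟪yI i, z⟫_ℂ)
  have hTO : ampl (I × ℕ) T xI ∈ O := by
    refine Set.mem_iInter.mpr fun i => ?_
    rw [Set.mem_ofPred_eq, hinner]
    exact (hu i.1 i.2).2
  obtain ⟨_, hz, m, hm, rfl⟩ :=
    mem_closure_iff.mp (ampl_mem_closure hD hMbim hMter hT xI) O hO hTO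
  refine hVM.subset (huV (a := fun ω => ω.1 m) fun ω hωI => ?_) hm
  have := Set.mem_iInter.mp hz ⟨ω, hωI⟩
  rwa [Set.mem_ofPred_eq, hinner] at this

end Density

section Distance

variable {H : Type*} [NormedAddCommGroup H] [InnerProductSpace ℂ H]

lemma arveson_nonneg (T : B H) (X : Set (B H)) : 0 ≤ arveson T X :=
  Real.iSup_nonneg fun _ => Real.iInf_nonneg fun _ => norm_nonneg _

lemma bddBelow_norm_sub (T : B H) (X : Set (B H)) (ξ : H) :
    BddBelow (Set.range fun S : X => ‖T ξ - S.1 ξ‖) :=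
  ⟨0, Set.forall_mem_range.mpr fun _ => norm_nonneg _⟩

/-- The spectral projection of a symmetry for the eigenvalue `1`. -/
def symmProj (s : B H) : B H := (2⁻¹ : ℂ) • (1 + s)

lemma symmProj_mul_mul {s t S : B H} (htt : t * t = 1) (h : s * S = S * t) :
    symmProj s * S * symmProj (-t) = 0 := by
  have : (1 + s) * S * (1 + -t) = 0 := by
    rw [add_mul, h, one_mul, mul_add, mul_one, mul_neg, add_mul, mul_assoc, htt, mul_one]
    abel
  simp only [symmProj, smul_mul_assoc, mul_smul_comm, this, smul_zero]

lemma symmProj_apply_add (s : B H) (x : H) : symmProj s x + symmProj (-s) x = x := by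
  simp only [symmProj, smul_apply, add_apply, neg_apply, one_apply_eq_self]
  module

lemma iInf_le_arveson {T : B H} {X : Set (B H)} (hX : (0 : B H) ∈ X) (ξ : {ξ : H // ‖ξ‖ = 1}) :
    ⨅ S : X, ‖T ξ.1 - S.1 ξ.1‖ ≤ arveson T X := by
  refine le_ciSup (f := fun ξ : {ξ : H // ‖ξ‖ = 1} => ⨅ S : X, ‖T ξ.1 - S.1 ξ.1‖)
    ⟨‖T‖, Set.forall_mem_range.mpr fun η => ?_⟩ ξ
  refine (ciInf_le (bddBelow_norm_sub T X η.1) ⟨0, hX⟩).trans ?_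
  simpa [η.2] using T.le_opNorm η.1

lemma arveson_le {T T' : B H} {X Y : Set (B H)} (hX : (0 : B H) ∈ X) (hXY : X ⊆ Y) :
    arveson T' Y ≤ arveson T X + ‖T - T'‖ := by
  refine Real.iSup_le (fun ξ => ?_) (add_nonneg (arveson_nonneg _ _) (norm_nonneg _))
  have : Nonempty X := ⟨⟨0, hX⟩⟩
  rw [← sub_le_iff_le_add]
  refine le_trans (le_ciInf fun S => ?_) (iInf_le_arveson hX ξ)
  rw [sub_le_iff_le_add]
  refine (ciInf_le (bddBelow_norm_sub T' Y ξ.1) ⟨S.1, hXY S.2⟩).trans ?_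
  have h1 : ‖T ξ.1 - T' ξ.1‖ ≤ ‖T - T'‖ := by
    simpa [ξ.2] using (T - T').le_opNorm ξ.1
  calc ‖T' ξ.1 - S.1 ξ.1‖ ≤ ‖T' ξ.1 - T ξ.1‖ + ‖T ξ.1 - S.1 ξ.1‖ :=
        norm_sub_le_norm_sub_add_norm_sub _ _ _
    _ ≤ ‖T ξ.1 - S.1 ξ.1‖ + ‖T - T'‖ := by
      rw [norm_sub_rev, add_comm]
      gcongr

lemma norm_compression_le {X : Submodule ℂ (B H)} {T P Q : B H} (hP : ‖P‖ ≤ 1)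
    (hX : ∀ S ∈ X, P * S * Q = 0) (ξ : H) :
    ‖P (T (Q ξ))‖ ≤ arveson T (X : Set (B H)) * ‖Q ξ‖ := by
  rcases eq_or_ne (Q ξ) 0 with h0 | h0
  · simp [h0]
  have hn : 0 < ‖Q ξ‖ := norm_pos_iff.mpr h0
  set η : H := ((‖Q ξ‖⁻¹ : ℝ) : ℂ) • Q ξ with hη
  have hη1 : ‖η‖ = 1 := by
    rw [hη, norm_smul, Complex.norm_real, norm_inv, norm_norm, inv_mul_cancel₀ hn.ne']
  have : Nonempty (X : Set (B H)) := ⟨⟨0, X.zero_mem⟩⟩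
  have hle : ‖P (T η)‖ ≤ arveson T (X : Set (B H)) := by
    refine le_trans (le_ciInf fun S => ?_) (iInf_le_arveson X.zero_mem ⟨η, hη1⟩)
    have hz : P (S.1 η) = 0 := by
      rw [hη, map_smul, map_smul]
      exact (congr_arg _ congr($(hX S.1 S.2) ξ)).trans (smul_zero _)
    calc ‖P (T η)‖ = ‖P (T η - S.1 η)‖ := by rw [map_sub, hz, sub_zero]
      _ ≤ 1 * ‖T η - S.1 η‖ := P.le_of_opNorm_le hP _
      _ = _ := one_mul _
  rw [hη, map_smul, map_smul, norm_smul, Complex.norm_real, norm_inv, norm_norm,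
    inv_mul_le_iff₀ hn] at hle
  linarith

variable [CompleteSpace H]

lemma norm_symmProj_le {s : B H} (hs : IsSelfAdjoint s) (hss : s * s = 1) : ‖symmProj s‖ ≤ 1 := by
  have hone : ‖(1 : B H)‖ ≤ 1 := ContinuousLinearMap.norm_id_le
  have hs1 : ‖s‖ ≤ 1 := norm_symmetry_le hs hss
  rw [symmProj, norm_smul, norm_inv, Complex.norm_ofNat]
  linarith [norm_add_le 1 s]

lemma norm_symmProj_add_sq {s : B H} (hs : IsSelfAdjoint s) (hss : s * s = 1) (x y : H) :
    ‖symmProj s x + symmProj (-s) y‖ ^ 2 = ‖symmProj s x‖ ^ 2 + ‖symmProj (-s) y‖ ^ 2 := by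
  have apply_apply (x : H) : s (s x) = x := congr($hss x)
  have inner_map (x y : H) : ⟪s x, y⟫_ℂ = ⟪x, s y⟫_ℂ := by
    conv_lhs => rw [← hs.star_eq, ContinuousLinearMap.star_eq_adjoint,
      ContinuousLinearMap.adjoint_inner_left]
  have h0 : ⟪symmProj s x, symmProj (-s) y⟫_ℂ = 0 := by
    simp only [symmProj, smul_apply, add_apply, neg_apply, one_apply_eq_self, inner_smul_left,
      inner_smul_right, inner_add_left, inner_add_right, inner_neg_right, inner_map, apply_apply]
    ring
  simpa only [sq] using norm_add_sq_eq_norm_sq_add_norm_sq_of_inner_eq_zero _ _ h0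

/-- The symmetries among the intertwiners. -/
def symmetries (D : StarSubalgebra ℂ (B H)) (M : Set (B H)) : Set (B H × B H) :=
  {s | s ∈ intertwiners D M ∧ IsSelfAdjoint s ∧ s * s = 1}

lemma norm_sub_conj_le {D : StarSubalgebra ℂ (B H)} {M X : Submodule ℂ (B H)} (hXM : X ≤ M)
    {s : B H × B H} (hs : s ∈ symmetries D M) (T : B H) :
    ‖T - s.1 * T * s.2‖ ≤ 2 * arveson T (X : Set (B H)) := by
  obtain ⟨hmem, hsa, hss⟩ := hs
  obtain ⟨s, t⟩ := s
  have hs : IsSelfAdjoint s := congr_arg Prod.fst hsa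
  have ht : IsSelfAdjoint t := congr_arg Prod.snd hsa
  have hss₁ : s * s = 1 := congr_arg Prod.fst hss
  have htt : t * t = 1 := congr_arg Prod.snd hss
  have hα := arveson_nonneg T (X : Set (B H))
  have hST : ∀ S ∈ X, s * S = S * t := fun S hS => (hmem.2.2 S (hXM hS)).1
  refine ContinuousLinearMap.opNorm_le_bound _ (by positivity) fun ξ => ?_
  have hdecomp : (T - s * T * t) ξ =
      (2 : ℂ) • (symmProj s (T (symmProj (-t) ξ)) + symmProj (-s) (T (symmProj t ξ))) := by
    simp only [symmProj, smul_apply, add_apply, sub_apply, neg_apply, one_apply_eq_self,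
      mul_apply_eq_comp, map_add, map_smul, map_neg]
    module
  have h1 := norm_compression_le (T := T) (norm_symmProj_le hs hss₁)
    (fun S hS => symmProj_mul_mul htt (hST S hS)) ξ
  have h2 := norm_compression_le (T := T) (P := symmProj (-s)) (Q := symmProj t) (X := X)
    (norm_symmProj_le hs.neg (by simpa using hss₁)) (fun S hS => by
      simpa using symmProj_mul_mul (s := -s) (t := -t) (S := S) (by simpa using htt)
        (by simpa using hST S hS)) ξ
  have h3 := norm_symmProj_add_sq hs hss₁ (T (symmProj (-t) ξ)) (T (symmProj t ξ))
  have h4 := norm_symmProj_add_sq ht htt ξ ξ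
  rw [symmProj_apply_add] at h4
  rw [hdecomp, norm_smul, Complex.norm_ofNat, mul_assoc]
  refine mul_le_mul_of_nonneg_left ((sq_le_sq₀ (norm_nonneg _) (by positivity)).mp ?_) two_pos.le
  calc _ ≤ (arveson T (X : Set (B H)) * ‖symmProj (-t) ξ‖) ^ 2 +
        (arveson T (X : Set (B H)) * ‖symmProj t ξ‖) ^ 2 := by
        rw [h3]
        gcongr
    _ = _ := by
      rw [mul_pow _ ‖ξ‖, h4]
      ring

lemma one_mem_symmetries (D : StarSubalgebra ℂ (B H)) (M : Set (B H)) : 1 ∈ symmetries D M :=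
  ⟨one_mem _, IsSelfAdjoint.one _, one_mul _⟩

lemma commute_of_mem_intertwiners {D : StarSubalgebra ℂ (B H)} (hD : IsMasa D) {M : Set (B H)}
    {s t : B H × B H} (hs : s ∈ intertwiners D M) (ht : t ∈ intertwiners D M) : Commute s t :=
  Prod.ext (hD.1 _ hs.1 _ ht.1) (hD.1 _ hs.2.1 _ ht.2.1)

lemma mul_mem_symmetries {D : StarSubalgebra ℂ (B H)} (hD : IsMasa D) {M : Set (B H)}
    {s t : B H × B H} (hs : s ∈ symmetries D M) (ht : t ∈ symmetries D M) :
    s * t ∈ symmetries D M := by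
  have hc := commute_of_mem_intertwiners hD hs.1 ht.1
  refine ⟨mul_mem hs.1 ht.1, (hs.2.1.commute_iff ht.2.1).mp hc, ?_⟩
  rw [hc.symm.mul_mul_mul_comm, hs.2.2, ht.2.2, one_mul]

/-- The convex hull of the conjugates of an operator by symmetries. -/
def hull (D : StarSubalgebra ℂ (B H)) (M : Set (B H)) (T : B H) : Set (B H) :=
  convexHull ℝ ((fun s : B H × B H => s.1 * T * s.2) '' symmetries D M)

lemma hull_subset {D : StarSubalgebra ℂ (B H)} {M : Set (B H)} {T : B H} {C : Set (B H)}
    (hC : Convex ℝ C) (h : ∀ s ∈ symmetries D M, s.1 * T * s.2 ∈ C) : hull D M T ⊆ C :=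
  convexHull_min (Set.image_subset_iff.mpr h) hC

lemma mem_hull_self {D : StarSubalgebra ℂ (B H)} {M : Set (B H)} (T : B H) : T ∈ hull D M T :=
  subset_convexHull ℝ _ ⟨1, one_mem_symmetries D M, by simp⟩

lemma conj_mem_hull {D : StarSubalgebra ℂ (B H)} (hD : IsMasa D) {M : Set (B H)} {T R : B H}
    {s : B H × B H} (hs : s ∈ symmetries D M) (hR : R ∈ hull D M T) :
    s.1 * R * s.2 ∈ hull D M T := by
  refine hull_subset (C := LinearMap.mulLeftRight ℝ (s.1, s.2) ⁻¹' hull D M T)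
    ((convex_convexHull ℝ _).linear_preimage _) (fun t ht => ?_) hR
  rw [Set.mem_preimage, LinearMap.mulLeftRight_apply]
  refine subset_convexHull ℝ _ ⟨s * t, mul_mem_symmetries hD hs ht, ?_⟩
  have hc : s.2 * t.2 = t.2 * s.2 := hD.1 _ hs.1.2.1 _ ht.1.2.1
  simp only [Prod.fst_mul, Prod.snd_mul, hc, mul_assoc]

lemma norm_le_of_mem_hull {D : StarSubalgebra ℂ (B H)} {M : Set (B H)} {T R : B H}
    (hR : R ∈ hull D M T) : ‖R‖ ≤ ‖T‖ := by
  refine mem_closedBall_zero_iff.mp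
    (hull_subset (convex_closedBall (0 : B H) ‖T‖) (fun s hs => ?_) hR)
  have h1 := norm_symmetry_le hs.2.1 hs.2.2
  have h2 : ‖s.1‖ ≤ 1 := (norm_fst_le s).trans h1
  have h3 : ‖s.2‖ ≤ 1 := (norm_snd_le s).trans h1
  rw [mem_closedBall_zero_iff]
  calc ‖s.1 * T * s.2‖ ≤ ‖s.1‖ * ‖T‖ * ‖s.2‖ :=
        (norm_mul_le _ _).trans (by gcongr; exact norm_mul_le _ _)
    _ ≤ 1 * ‖T‖ * 1 := by gcongr
    _ = ‖T‖ := by ring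

lemma norm_sub_le_of_mem_hull {D : StarSubalgebra ℂ (B H)} {M X : Submodule ℂ (B H)} (hXM : X ≤ M)
    {T R : B H} (hR : R ∈ hull D M T) : ‖T - R‖ ≤ 2 * arveson T (X : Set (B H)) := by
  rw [norm_sub_rev]
  refine mem_closedBall_iff_norm.mp (hull_subset (convex_closedBall T _) (fun s hs => ?_) hR)
  rw [mem_closedBall_iff_norm, norm_sub_rev]
  exact norm_sub_conj_le hXM hs T

lemma mem_of_mem_hull {D : StarSubalgebra ℂ (B H)} {M : Set (B H)} {U : Submodule ℂ (B H)}
    (hU : IsBimodule D U) {T R : B H} (hT : T ∈ U) (hR : R ∈ hull D M T) : R ∈ U :=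
  hull_subset (U.restrictScalars ℝ).convex (fun _ hs => hU _ hs.1.1 _ hs.1.2.1 _ hT) hR

/-- Averaging over finitely many commuting symmetries. -/
lemma exists_average {D : StarSubalgebra ℂ (B H)} (hD : IsMasa D) {M : Set (B H)}
    (F : Finset (symmetries D M)) : ∃ Φ : B H →ₗ[ℂ] B H, (∀ R, Φ R ∈ hull D M R) ∧
      (∀ R, ∀ s ∈ F, s.1.1 * Φ R * s.1.2 = Φ R) ∧
      ∀ R, (∀ s ∈ F, s.1.1 * R * s.1.2 = R) → Φ R = R := by
  classical
  induction F using Finset.induction_on with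
  | empty => exact ⟨LinearMap.id, fun R => mem_hull_self R, by simp, by simp⟩
  | insert s F _ ih =>
    obtain ⟨Φ, hmem, hinv, hfix⟩ := ih
    obtain ⟨⟨s, t⟩, hst⟩ := s
    have hss : s * s = 1 := congr_arg Prod.fst hst.2.2
    have htt : t * t = 1 := congr_arg Prod.snd hst.2.2
    refine ⟨(2⁻¹ : ℂ) • (Φ + LinearMap.mulLeftRight ℂ (s, t) ∘ₗ Φ), fun R => ?_, fun R => ?_,
      fun R hR => ?_⟩
    · have h2 : (2⁻¹ : ℂ) = ((2⁻¹ : ℝ) : ℂ) := by push_cast; rfl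
      rw [LinearMap.smul_apply, h2, Complex.coe_smul, LinearMap.add_apply, smul_add]
      exact convex_convexHull ℝ _ (hmem R) (conj_mem_hull hD hst (hmem R))
        (by norm_num) (by norm_num) (by norm_num)
    · simp only [Finset.forall_mem_insert, LinearMap.smul_apply, LinearMap.add_apply,
        LinearMap.comp_apply, LinearMap.mulLeftRight_apply, mul_smul_comm, smul_mul_assoc,
        mul_add, add_mul]
      refine ⟨?_, fun r hr => ?_⟩
      · rw [← mul_assoc s, ← mul_assoc s, hss, one_mul, mul_assoc _ t t, htt, mul_one, add_comm]
      · have h1 : r.1.1 * s = s * r.1.1 := hD.1 _ r.2.1.1 _ hst.1.1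
        have h2 : t * r.1.2 = r.1.2 * t := hD.1 _ hst.1.2.1 _ r.2.1.2.1
        have h3 : r.1.1 * (s * Φ R * t) * r.1.2 = s * (r.1.1 * Φ R * r.1.2) * t := by
          simp only [mul_assoc, h2]
          simp only [← mul_assoc, h1]
        rw [h3, hinv R r hr]
    · rw [Finset.forall_mem_insert] at hR
      have h := hR.1
      simp only [LinearMap.smul_apply, LinearMap.add_apply, LinearMap.comp_apply,
        LinearMap.mulLeftRight_apply, hfix R hR.2]
      rw [h]
      module

lemma exists_mem_inter {D : StarSubalgebra ℂ (B H)} (hD : IsMasa D) {U M : Submodule ℂ (B H)}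
    (hUbim : IsBimodule D U) (hUcl : WStarClosed H (U : Set (B H)))
    (hMbim : IsBimodule D M) (hMcl : WStarClosed H (M : Set (B H))) (hMter : IsTernary M) {k : ℝ}
    (hk : k ∈ hyperSet (U : Set (B H))) (T : B H) {ε : ℝ} (hε : 0 < ε) :
    ∃ R ∈ U ⊓ M, ‖T - R‖ ≤ (2 + 3 * k) * arveson T (U ⊓ M : Submodule ℂ (B H)) + ε := by
  set α := arveson T ((U ⊓ M : Submodule ℂ (B H)) : Set (B H)) with hα
  have approx (F : Finset (symmetries D (M : Set (B H)))) : ∃ S ∈ U,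
      (∀ s ∈ F, s.1.1 * S * s.1.2 = S) ∧ ‖T - S‖ ≤ (2 + 3 * k) * α + ε := by
    obtain ⟨Φ, hmem, hinv, hfix⟩ := exists_average hD F
    have hTΦ : ‖T - Φ T‖ ≤ 2 * α := norm_sub_le_of_mem_hull inf_le_right (hmem T)
    have hdist : Metric.infDist (Φ T) (U : Set (B H)) < 3 * k * α + ε := by
      calc Metric.infDist (Φ T) (U : Set (B H)) ≤ k * arveson (Φ T) (U : Set (B H)) := hk.2 _
        _ ≤ k * (α + 2 * α) := by
          have := hk.1
          gcongr
          exact (arveson_le (zero_mem (U ⊓ M)) (fun _ h => h.1)).trans (by gcongr)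
        _ < _ := by linarith
    obtain ⟨V, hV, hVd⟩ := (Metric.infDist_lt_iff ⟨0, U.zero_mem⟩).mp hdist
    refine ⟨Φ V, mem_of_mem_hull hUbim hV (hmem V), hinv V, ?_⟩
    have h1 : ‖Φ T - Φ V‖ ≤ ‖Φ T - V‖ := by
      conv_lhs => rw [← hfix (Φ T) (hinv T), ← map_sub]
      exact norm_le_of_mem_hull (hmem _)
    rw [dist_eq_norm] at hVd
    linarith [norm_sub_le_norm_sub_add_norm_sub T (Φ T) (Φ V)]
  choose S hSU hinv hTS using approx
  have hS (F) : ‖S F‖ ≤ ‖T‖ + ((2 + 3 * k) * α + ε) := by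
    calc ‖S F‖ = ‖T - (T - S F)‖ := by rw [sub_sub_cancel]
      _ ≤ ‖T‖ + ‖T - S F‖ := norm_sub_le _ _
      _ ≤ _ := by gcongr; exact hTS F
  obtain ⟨R, hR⟩ := exists_weakTendsto (Ultrafilter.of atTop) hS
  refine ⟨R, ⟨hR.mem_of_wStarClosed hS hUcl hSU, ?_⟩, (hR.const_sub T).norm_le hTS⟩
  refine mem_of_intertwines hD hMbim hMcl hMter fun p hp =>
    intertwines_of_symmetries hD (fun s hs hsa hss => ?_) hp
  have hconj : s.1 * R * s.2 = R := by
    refine (hR.mul_mul s.1 s.2).unique (hR.congr' ?_)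
    refine Ultrafilter.of_le atTop ((eventually_ge_atTop {⟨s, hs, hsa, hss⟩}).mono fun F hF => ?_)
    exact (hinv F ⟨s, hs, hsa, hss⟩ (Finset.singleton_subset_iff.mp hF)).symm
  conv_rhs => rw [← hconj, mul_assoc, show s.2 * s.2 = 1 from congr_arg Prod.snd hss, mul_one]

lemma mem_hyperSet_inter {D : StarSubalgebra ℂ (B H)} (hD : IsMasa D) {U M : Submodule ℂ (B H)}
    (hUbim : IsBimodule D U) (hUcl : WStarClosed H (U : Set (B H)))
    (hMbim : IsBimodule D M) (hMcl : WStarClosed H (M : Set (B H))) (hMter : IsTernary M) {k : ℝ}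
    (hk : k ∈ hyperSet (U : Set (B H))) : 2 + 3 * k ∈ hyperSet ((U : Set (B H)) ∩ M) := by
  refine ⟨by linarith [hk.1], fun T => le_of_forall_pos_le_add fun ε hε => ?_⟩
  obtain ⟨R, hR, hTR⟩ := exists_mem_inter hD hUbim hUcl hMbim hMcl hMter hk T hε
  exact (Metric.infDist_le_dist_of_mem hR).trans ((dist_eq_norm T R).trans_le hTR)

end Distance

end SchurHyper


/-- if `U` is a hyperreflexive weak* closed masa-bimodule and `M`
is a ternary masa-bimodule, then `U ∩ M` is hyperreflexive and
`k(U ∩ M) ≤ 2 + 3·k(U)`. -/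
theorem stmt16 {H : Type*} [NormedAddCommGroup H] [InnerProductSpace ℂ H] [CompleteSpace H]
    [TopologicalSpace.SeparableSpace H]
    (D : StarSubalgebra ℂ (B H)) (hD : IsMasa D)
    (U : Submodule ℂ (B H)) (hUbim : IsBimodule D U)
    (hUcl : WStarClosed H (U : Set (B H))) (hUhr : Hyperreflexive (U : Set (B H)))
    (M : Submodule ℂ (B H)) (hMbim : IsBimodule D M)
    (hMcl : WStarClosed H (M : Set (B H))) (hMter : IsTernary M) :
    Hyperreflexive ((U : Set (B H)) ∩ (M : Set (B H))) ∧
    hyperConst ((U : Set (B H)) ∩ (M : Set (B H))) ≤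
      2 + 3 * hyperConst (U : Set (B H)) := by
  have mem {k : ℝ} (hk : k ∈ hyperSet (U : Set (B H))) :=
    mem_hyperSet_inter hD hUbim hUcl hMbim hMcl hMter hk
  refine ⟨hUhr.imp' _ fun k hk => mem hk, ?_⟩
  have h : (hyperConst ((U : Set (B H)) ∩ (M : Set (B H))) - 2) / 3 ≤ hyperConst (U : Set (B H)) :=
    le_csInf hUhr fun k hk => by
      have := csInf_le (s := hyperSet ((U : Set (B H)) ∩ M)) ⟨0, fun _ h => h.1.le⟩ (mem hk)
      rw [hyperConst]
      linarith
  linarith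
end
end
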